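/- Let (X,ρ,μ) be a quasi-metric measure space in which μ is Borel regular and Q-doubling for some Q ∈ (0,∞), and let Ω ⊂ X be a μ-measurable locally uniformly perfect set. Suppose Ω is an M^s_{p,q}-extension domain for some p ∈ (0,∞), q ∈ (0,∞], and s ∈ (0,∞) with s ⪯_q ind(X,ρ); that is, there exists C > 0 such that every u ∈ M^s_{p,q}(Ω,ρ,μ) admits ũ ∈ M^s_{p,q}(X,ρ,μ) with ũ|_Ω = u and ‖ũ‖_{M^s_{p,q}(X,ρ,μ)} ≤ C ‖u‖_{M^s_{p,q}(Ω,ρ,μ)}. Then Ω satisfies the measure density condition: there is C_μ > 0 with μ(B_ρ(x,r)) ≤ C_μ μ(B_ρ(x,r)∩Ω) for all x ∈ Ω and r ∈ (0,1]. -/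

import Mathlib

open MeasureTheory ENNReal Set

noncomputable section

namespace HajlaszPaper

variable {X : Type*}

/-- The `ρ`-ball centered at `x` with radius `r`. -/
def qball (ρ : X → X → ℝ) (x : X) (r : ℝ) : Set X := {y | ρ x y < r}

/-- `ρ` is a quasi-metric on `X`. -/
def IsQuasiDist (ρ : X → X → ℝ) : Prop :=
  (∀ x y, 0 ≤ ρ x y) ∧ (∀ x y, ρ x y = 0 ↔ x = y) ∧
    (∃ C₀ : ℝ, 1 ≤ C₀ ∧ ∀ x y, ρ y x ≤ C₀ * ρ x y) ∧
    (∃ C₁ : ℝ, 1 ≤ C₁ ∧ ∀ x y z, ρ x y ≤ C₁ * max (ρ x z) (ρ z y))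

/-- The least admissible quasi-triangle constant `C_ρ`. -/
def Crho (ρ : X → X → ℝ) : ℝ :=
  sInf {C : ℝ | 1 ≤ C ∧ ∀ x y z : X, ρ x y ≤ C * max (ρ x z) (ρ z y)}

/-- The least admissible quasi-symmetry constant `C̃_ρ`. -/
def CrhoTilde (ρ : X → X → ℝ) : ℝ :=
  sInf {C : ℝ | 1 ≤ C ∧ ∀ x y : X, ρ y x ≤ C * ρ x y}

/-- Two quasi-metrics are (bi-Lipschitz, i.e. pointwise) equivalent. -/
def EquivQM (ρ ϱ : X → X → ℝ) : Prop :=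
  ∃ c : ℝ, 1 ≤ c ∧ ∀ x y, c⁻¹ * ϱ x y ≤ ρ x y ∧ ρ x y ≤ c * ϱ x y

variable [MeasurableSpace X]

/-- `(X, ρ, μ)` is a quasi-metric measure space. -/
structure IsQMMS (ρ : X → X → ℝ) (μ : Measure X) : Prop where
  nontrivial : ∃ x y : X, x ≠ y
  quasi : IsQuasiDist ρ
  measurableSet_ball : ∀ (x : X) (r : ℝ), 0 < r → MeasurableSet (qball ρ x r)
  ball_pos : ∀ (x : X) (r : ℝ), 0 < r → 0 < μ (qball ρ x r)
  ball_lt_top : ∀ (x : X) (r : ℝ), 0 < r → μ (qball ρ x r) < ∞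

/-- Every `μ`-measurable set is contained in a Borel (measurable) set of equal measure. -/
def BorelRegular (μ : Measure X) : Prop :=
  ∀ A : Set X, ∃ B : Set X, A ⊆ B ∧ MeasurableSet B ∧ μ A = μ B

/-- `μ` is `Q`-doubling. -/
def QDoubling (ρ : X → X → ℝ) (μ : Measure X) (Q : ℝ) : Prop :=
  ∃ κ : ℝ, 0 < κ ∧ ∀ (x y : X) (r R : ℝ), 0 < r → r ≤ R →
    qball ρ x r ⊆ qball ρ y R →
    ENNReal.ofReal (κ * (r / R) ^ Q) * μ (qball ρ y R) ≤ μ (qball ρ x r)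

/-- `μ` is doubling. -/
def DoublingMeas (ρ : X → X → ℝ) (μ : Measure X) : Prop :=
  ∃ Cd : ℝ, 0 < Cd ∧ ∀ (x : X) (r : ℝ), 0 < r →
    μ (qball ρ x (2 * r)) ≤ ENNReal.ofReal Cd * μ (qball ρ x r)

/-- The measure density condition for `Ω`. -/
def MeasDensity (ρ : X → X → ℝ) (μ : Measure X) (Ω : Set X) : Prop :=
  ∃ c : ℝ, 0 < c ∧ ∀ x ∈ Ω, ∀ r : ℝ, 0 < r → r ≤ 1 →
    μ (qball ρ x r) ≤ ENNReal.ofReal c * μ (qball ρ x r ∩ Ω)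

/-- `Ω` is locally uniformly perfect with constant `lam ∈ (0,1)`. -/
def LocUnifPerfect (ρ : X → X → ℝ) (Ω : Set X) (lam : ℝ) : Prop :=
  ∀ x ∈ Ω, ∀ r : ℝ, 0 < r → r ≤ 1 → (Ω \ qball ρ x r).Nonempty →
    ((qball ρ x r ∩ Ω) \ qball ρ x (lam * r)).Nonempty

/-- The critical radius `φ^x_{Ω,ρ}(r)`. -/
def phiRad (ρ : X → X → ℝ) (μ : Measure X) (Ω : Set X) (x : X) (r : ℝ) : ℝ :=
  sSup {t : ℝ | 0 ≤ t ∧ t ≤ r ∧ μ (qball ρ x t ∩ Ω) ≤ μ (qball ρ x r ∩ Ω) / 2}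

/-- The collection `𝔻^s_ρ(u)` of fractional `s`-gradients of `u` on `Ω`. -/
def fracGrad (ρ : X → X → ℝ) (μ : Measure X) (Ω : Set X) (s : ℝ) (u : X → ℝ) :
    Set (ℤ → X → ℝ) :=
  {g | (∀ k x, 0 ≤ g k x) ∧ (∀ k, AEMeasurable (g k) (μ.restrict Ω)) ∧
    ∃ E : Set X, μ E = 0 ∧ ∀ k : ℤ, ∀ x ∈ Ω \ E, ∀ y ∈ Ω \ E,
      (2 : ℝ) ^ (-k - 1) ≤ ρ x y → ρ x y < (2 : ℝ) ^ (-k) →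
      |u x - u y| ≤ ρ x y ^ s * (g k x + g k y)}

/-- `g` is an `s`-gradient of `u` on `S`. -/
def IsSGradOn (ρ : X → X → ℝ) (μ : Measure X) (S : Set X) (s : ℝ) (u g : X → ℝ) : Prop :=
  (∀ x, 0 ≤ g x) ∧ AEMeasurable g (μ.restrict S) ∧
    ∃ E : Set X, μ E = 0 ∧ ∀ x ∈ S \ E, ∀ y ∈ S \ E,
      |u x - u y| ≤ ρ x y ^ s * (g x + g y)

/-- The `ℓ^q` norm (`0 < q ≤ ∞`) of a `ℤ`-indexed sequence in `[0,∞]`. -/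
def lqN (q : ℝ≥0∞) (a : ℤ → ℝ≥0∞) : ℝ≥0∞ :=
  if q = ∞ then ⨆ k, a k else (∑' k, a k ^ q.toReal) ^ (1 / q.toReal)

/-- The `L^p` "norm" (`0 < p < ∞`) of a `[0,∞]`-valued function. -/
def lpN (μ : Measure X) (p : ℝ) (f : X → ℝ≥0∞) : ℝ≥0∞ :=
  (∫⁻ x, f x ^ p ∂μ) ^ (1 / p)

/-- The `L^p` norm of `u : X → ℝ` over the set `Ω`. -/
def lpOn (μ : Measure X) (Ω : Set X) (p : ℝ) (u : X → ℝ) : ℝ≥0∞ :=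
  lpN (μ.restrict Ω) p fun x => ENNReal.ofReal |u x|

/-- The homogeneous Hajłasz–Triebel–Lizorkin quasi-norm `‖u‖_{Ṁ^s_{p,q}(Ω,ρ,μ)}`. -/
def MdotNorm (ρ : X → X → ℝ) (μ : Measure X) (Ω : Set X) (s p : ℝ) (q : ℝ≥0∞)
    (u : X → ℝ) : ℝ≥0∞ :=
  ⨅ g ∈ fracGrad ρ μ Ω s u,
    lpN (μ.restrict Ω) p fun x => lqN q fun k => ENNReal.ofReal (g k x)

/-- The homogeneous Hajłasz–Besov quasi-norm `‖u‖_{Ṅ^s_{p,q}(Ω,ρ,μ)}`. -/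
def NdotNorm (ρ : X → X → ℝ) (μ : Measure X) (Ω : Set X) (s p : ℝ) (q : ℝ≥0∞)
    (u : X → ℝ) : ℝ≥0∞ :=
  ⨅ g ∈ fracGrad ρ μ Ω s u,
    lqN q fun k => lpN (μ.restrict Ω) p fun x => ENNReal.ofReal (g k x)

/-- Membership in `M^s_{p,q}(Ω,ρ,μ)`. -/
def MemMspq (ρ : X → X → ℝ) (μ : Measure X) (Ω : Set X) (s p : ℝ) (q : ℝ≥0∞)
    (u : X → ℝ) : Prop :=
  AEMeasurable u (μ.restrict Ω) ∧ lpOn μ Ω p u ≠ ∞ ∧ MdotNorm ρ μ Ω s p q u ≠ ∞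

/-- Membership in `N^s_{p,q}(Ω,ρ,μ)`. -/
def MemNspq (ρ : X → X → ℝ) (μ : Measure X) (Ω : Set X) (s p : ℝ) (q : ℝ≥0∞)
    (u : X → ℝ) : Prop :=
  AEMeasurable u (μ.restrict Ω) ∧ lpOn μ Ω p u ≠ ∞ ∧ NdotNorm ρ μ Ω s p q u ≠ ∞

/-- The quasi-norm of `M^s_{p,q}(Ω,ρ,μ)`. -/
def MNorm (ρ : X → X → ℝ) (μ : Measure X) (Ω : Set X) (s p : ℝ) (q : ℝ≥0∞)
    (u : X → ℝ) : ℝ≥0∞ :=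
  MdotNorm ρ μ Ω s p q u + lpOn μ Ω p u

/-- The quasi-norm of `N^s_{p,q}(Ω,ρ,μ)`. -/
def NNorm (ρ : X → X → ℝ) (μ : Measure X) (Ω : Set X) (s p : ℝ) (q : ℝ≥0∞)
    (u : X → ℝ) : ℝ≥0∞ :=
  NdotNorm ρ μ Ω s p q u + lpOn μ Ω p u

/-- `s ⪯_q ind(X,ρ)` : there is a quasi-metric `ϱ ≈ ρ` with `s ≤ (log₂ C_ϱ)⁻¹`
(equivalently `C_ϱ ^ s ≤ 2`), where equality is permitted only when `q = ∞`. -/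
def SPrecIndex (ρ : X → X → ℝ) (s : ℝ) (q : ℝ≥0∞) : Prop :=
  ∃ ϱ : X → X → ℝ, IsQuasiDist ϱ ∧ EquivQM ρ ϱ ∧
    (Crho ϱ ^ s < 2 ∨ (q = ∞ ∧ Crho ϱ ^ s ≤ 2))

/-- `s < ind(X,ρ)` : there is a quasi-metric `ϱ ≈ ρ` with `s < (log₂ C_ϱ)⁻¹`
(equivalently `C_ϱ ^ s < 2`). -/
def SLtIndex (ρ : X → X → ℝ) (s : ℝ) : Prop :=
  ∃ ϱ : X → X → ℝ, IsQuasiDist ϱ ∧ EquivQM ρ ϱ ∧ Crho ϱ ^ s < 2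

/-- The median value `m_u(E)`. -/
def medianVal (μ : Measure X) (E : Set X) (u : X → ℝ) : ℝ :=
  sSup {θ : ℝ | μ {x ∈ E | u x < θ} ≤ μ E / 2}

/-- `f` belongs to the homogeneous Hölder space `Ċ^α(X,ρ)`. -/
def MemHolder (ρ : X → X → ℝ) (α : ℝ) (f : X → ℝ) : Prop :=
  ∃ H : ℝ, 0 ≤ H ∧ ∀ x y : X, |f x - f y| ≤ H * ρ x y ^ α

/-- The Hölder seminorm `‖f‖_{Ċ^α(X,ρ)}`. -/
def holderNorm (ρ : X → X → ℝ) (α : ℝ) (f : X → ℝ) : ℝ :=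
  sInf {H : ℝ | 0 ≤ H ∧ ∀ x y : X, |f x - f y| ≤ H * ρ x y ^ α}

/-- The sup norm of `f`. -/
def supNorm (f : X → ℝ) : ℝ := sSup (Set.range fun x => |f x|)

/-- `ρ` is a genuine metric. -/
def IsMetricDist (ρ : X → X → ℝ) : Prop :=
  (∀ x y, 0 ≤ ρ x y) ∧ (∀ x y, ρ x y = 0 ↔ x = y) ∧ (∀ x y, ρ x y = ρ y x) ∧
    (∀ x y z, ρ x y ≤ ρ x z + ρ z y)

/-- The homogeneous Hajłasz–Sobolev quasi-norm `‖u‖_{Ṁ^{1,p}(Ω,ρ,μ)}`. -/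
def M1pDotNorm (ρ : X → X → ℝ) (μ : Measure X) (Ω : Set X) (p : ℝ) (u : X → ℝ) : ℝ≥0∞ :=
  ⨅ g ∈ {g : X → ℝ | IsSGradOn ρ μ Ω 1 u g},
    lpN (μ.restrict Ω) p fun x => ENNReal.ofReal (g x)

/-- Membership in the Hajłasz–Sobolev space `M^{1,p}(Ω,ρ,μ)`. -/
def MemM1p (ρ : X → X → ℝ) (μ : Measure X) (Ω : Set X) (p : ℝ) (u : X → ℝ) : Prop :=
  AEMeasurable u (μ.restrict Ω) ∧ lpOn μ Ω p u ≠ ∞ ∧ M1pDotNorm ρ μ Ω p u ≠ ∞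

/-- The quasi-norm of `M^{1,p}(Ω,ρ,μ)`. -/
def M1pNorm (ρ : X → X → ℝ) (μ : Measure X) (Ω : Set X) (p : ℝ) (u : X → ℝ) : ℝ≥0∞ :=
  lpOn μ Ω p u + M1pDotNorm ρ μ Ω p u


theorem chain_sum_bound {X : Type*} {N : X → X → ℝ} (h0 : ∀ x y, 0 ≤ N x y)
    (h2 : ∀ x y z, N x y ≤ 2 * max (N x z) (N z y)) (n : ℕ) (hn : 1 ≤ n) (f : ℕ → X) :
    N (f 0) (f (n + 1)) ≤ 4 * ∑ i ∈ Finset.range (n + 1), N (f i) (f (i + 1))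
      - 2 * N (f 0) (f 1) - 2 * N (f n) (f (n + 1)) := by
  induction n using Nat.strong_induction_on generalizing f with
  | _ n ih =>
  have hends : N (f 0) (f 1) + N (f n) (f (n + 1))
      ≤ ∑ i ∈ Finset.range (n + 1), N (f i) (f (i + 1)) := by
    rw [Finset.sum_range_succ]
    gcongr
    exact Finset.single_le_sum (f := fun i => N (f i) (f (i + 1))) (fun i _ => h0 _ _)
      (Finset.mem_range.2 hn)
  have he0 := h0 (f 0) (f 1)
  have hen := h0 (f n) (f (n + 1))
  classical
  set P : ℕ → Prop := fun i => N (f 0) (f (n + 1)) ≤ 2 * N (f i) (f (n + 1)) with hP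
  have hP0 : P 0 := by have := h0 (f 0) (f (n + 1)); simp only [hP]; linarith
  obtain ⟨i, hi⟩ : ∃ i, Nat.findGreatest P n = i := ⟨_, rfl⟩
  have hPi : P i := hi ▸ Nat.findGreatest_spec (Nat.zero_le n) hP0
  have hin : i ≤ n := hi ▸ Nat.findGreatest_le n
  simp only [hP] at hPi
  rcases hin.eq_or_lt with rfl | hlt
  · linarith
  have hnot : ¬ P (i + 1) := Nat.findGreatest_is_greatest (by omega) hlt
  simp only [hP, not_le] at hnot
  have hleft : N (f 0) (f (n + 1)) ≤ 2 * N (f 0) (f (i + 1)) := by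
    have := h2 (f 0) (f (n + 1)) (f (i + 1))
    rcases max_cases (N (f 0) (f (i + 1))) (N (f (i + 1)) (f (n + 1))) with h | h <;>
      rw [h.1] at this <;> linarith
  rcases Nat.eq_zero_or_pos i with rfl | hipos
  · simp only [zero_add] at hleft; linarith
  have hA := ih i hlt hipos f
  have hB := ih (n - i) (by omega) (by omega) (fun j => f (i + j))
  have e1 : i + (n - i + 1) = n + 1 := by omega
  have e2 : i + (n - i) = n := by omega
  simp only [add_zero, e1, e2] at hB
  have hsplit := Finset.sum_range_add (fun j => N (f j) (f (j + 1))) i (n - i + 1)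
  rw [e1] at hsplit
  rw [Finset.sum_range_succ] at hA
  simp only [← add_assoc] at hB hsplit
  linarith

theorem exists_chain_of_list {X M : Type*} [AddCommMonoid M] (d : X → X → M) (l : List X)
    (x y : X) : ∃ f : ℕ → X, f 0 = x ∧ f (l.length + 1) = y ∧
      (List.zipWith d (x :: l) (l ++ [y])).sum
        = ∑ i ∈ Finset.range (l.length + 1), d (f i) (f (i + 1)) := by
  induction l generalizing x with
  | nil => exact ⟨fun n => Nat.casesOn n x fun _ => y, rfl, rfl, by simp⟩
  | cons z l ih =>
    obtain ⟨f, hf0, hf1, hf⟩ := ih z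
    refine ⟨fun n => Nat.casesOn n x f, rfl, by simpa using hf1, ?_⟩
    rw [Finset.sum_range_succ']
    simp only [List.length_cons, List.cons_append, List.zipWith_cons_cons, List.sum_cons, hf0]
    rw [← hf, add_comm]
    rfl

/-- Frink's metrization lemma with the sharp constant `2`. -/
theorem exists_pseudoMetric {X : Type*} {N : X → X → ℝ} (h0 : ∀ x y, 0 ≤ N x y)
    (hself : ∀ x, N x x = 0) (hsymm : ∀ x y, N x y = N y x)
    (h2 : ∀ x y z, N x y ≤ 2 * max (N x z) (N z y)) :
    ∃ _ : PseudoMetricSpace X, ∀ x y, dist x y ≤ N x y ∧ N x y ≤ 4 * dist x y := by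
  let d : X → X → NNReal := fun x y => ⟨N x y, h0 x y⟩
  have dself : ∀ x, d x x = 0 := fun x => Subtype.ext (hself x)
  have dsymm : ∀ x y, d x y = d y x := fun x y => Subtype.ext (hsymm x y)
  refine ⟨PseudoMetricSpace.ofPreNNDist d dself dsymm, fun x y =>
    ⟨PseudoMetricSpace.dist_ofPreNNDist_le d dself dsymm x y, ?_⟩⟩
  rw [PseudoMetricSpace.dist_ofPreNNDist]
  have key : d x y ≤ 4 * ⨅ l : List X, (List.zipWith d (x :: l) (l ++ [y])).sum := by
    rw [NNReal.mul_iInf]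
    refine le_ciInf fun l => ?_
    obtain ⟨f, hf0, hf1, hf⟩ := exists_chain_of_list d l x y
    rw [hf, ← NNReal.coe_le_coe]
    push_cast
    change N x y ≤ 4 * ∑ i ∈ Finset.range (l.length + 1), N (f i) (f (i + 1))
    rw [← hf0, ← hf1]
    rcases Nat.eq_zero_or_pos l.length with h | h
    · rw [h]
      have := h0 (f 0) (f 1)
      simp only [zero_add, Finset.sum_range_one]
      linarith
    · have := chain_sum_bound h0 h2 _ h f
      have h3 := h0 (f 0) (f 1)
      have h4 := h0 (f l.length) (f (l.length + 1))
      linarith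
  exact_mod_cast NNReal.coe_le_coe.2 key

theorem Crho_spec {X : Type*} {ρ : X → X → ℝ} (hρ : IsQuasiDist ρ) :
    1 ≤ Crho ρ ∧ ∀ x y z : X, ρ x y ≤ Crho ρ * max (ρ x z) (ρ z y) := by
  obtain ⟨h0, -, -, C₁, hC₁⟩ := hρ
  have hclosed : IsClosed {C : ℝ | 1 ≤ C ∧ ∀ x y z : X, ρ x y ≤ C * max (ρ x z) (ρ z y)} := by
    simp only [ofPred_and, ofPred_forall]
    refine isClosed_Ici.inter ?_
    refine isClosed_iInter fun x => isClosed_iInter fun y => isClosed_iInter fun z => ?_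
    exact isClosed_le continuous_const (continuous_id.mul continuous_const)
  exact hclosed.csInf_mem ⟨C₁, hC₁⟩ ⟨1, fun C hC => hC.1⟩

theorem exists_gt_rpow_le_two {K s : ℝ} (hK : 1 ≤ K) (h : K ^ s < 2) :
    ∃ α, s < α ∧ K ^ α ≤ 2 := by
  have hcont : ContinuousAt (fun t : ℝ => K ^ t) s :=
    (Real.continuous_const_rpow (by positivity)).continuousAt
  have hev := hcont.eventually_lt_const h
  obtain ⟨ε, hε, hball⟩ := Metric.eventually_nhds_iff.1 hev
  refine ⟨s + ε / 2, by linarith, (hball ?_).le⟩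
  rw [Real.dist_eq, add_sub_cancel_left, abs_of_pos (by positivity)]
  linarith

/-- An admissible smoothness index provides a pseudo-metric comparable with a power of `ρ`. -/
theorem exists_snowflake {X : Type*} {ρ : X → X → ℝ} (hρ : IsQuasiDist ρ) {s : ℝ} {q : ℝ≥0∞}
    (hs : 0 < s) (hind : SPrecIndex ρ s q) :
    ∃ α, ((q = ∞ ∧ α = s) ∨ s < α) ∧ ∃ _ : PseudoMetricSpace X, ∃ c : ℝ, 1 ≤ c ∧
      ∀ x y, dist x y ≤ c * ρ x y ^ α ∧ ρ x y ^ α ≤ c * dist x y := by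
  obtain ⟨ϱ, hϱ, ⟨c, hc, hcomp⟩, hK⟩ := hind
  obtain ⟨hK1, hKt⟩ := Crho_spec hϱ
  obtain ⟨α, hα, hKα⟩ : ∃ α, ((q = ∞ ∧ α = s) ∨ s < α) ∧ Crho ϱ ^ α ≤ 2 := by
    rcases hK with h | ⟨hq, h⟩
    · obtain ⟨α, h1, h2⟩ := exists_gt_rpow_le_two hK1 h
      exact ⟨α, .inr h1, h2⟩
    · exact ⟨s, .inl ⟨hq, rfl⟩, h⟩
  have hα0 : 0 < α := by rcases hα with ⟨-, rfl⟩ | h <;> linarith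
  refine ⟨α, hα, ?_⟩
  obtain ⟨hϱ0, hϱeq, ⟨C₀, hC₀, hϱs⟩, -⟩ := hϱ
  have hm0 : ∀ x y, 0 ≤ max (ϱ x y) (ϱ y x) := fun x y => le_max_of_le_left (hϱ0 x y)
  have hmt : ∀ x y z, max (ϱ x y) (ϱ y x)
      ≤ Crho ϱ * max (max (ϱ x z) (ϱ z x)) (max (ϱ z y) (ϱ y z)) := by
    intro x y z
    refine max_le ((hKt x y z).trans ?_) ((hKt y x z).trans ?_)
    · gcongr
      exacts [le_max_left _ _, le_max_left _ _]
    · rw [max_comm (ϱ y z)]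
      gcongr
      exacts [le_max_right _ _, le_max_right _ _]
  obtain ⟨m, hm⟩ := exists_pseudoMetric (N := fun x y => max (ϱ x y) (ϱ y x) ^ α)
    (fun x y => Real.rpow_nonneg (hm0 x y) _)
    (fun x => by simp [(hϱeq x x).2 rfl, Real.zero_rpow hα0.ne'])
    (fun x y => by rw [max_comm])
    (fun x y z => by
      refine (Real.rpow_le_rpow (hm0 x y) (hmt x y z) hα0.le).trans ?_
      rw [Real.mul_rpow (by linarith) (le_max_of_le_left (hm0 x z)),
        (Real.monotoneOn_rpow_Ici_of_exponent_nonneg hα0.le).map_max (hm0 x z) (hm0 z y)]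
      gcongr
      exact le_max_of_le_left (Real.rpow_nonneg (hm0 x z) _))
  have hρ0 := hρ.1
  have hc0 : 0 < c := by linarith
  have hCc : 1 ≤ C₀ * c := by nlinarith
  have hle1 : ∀ x y, max (ϱ x y) (ϱ y x) ≤ (C₀ * c) * ρ x y := by
    intro x y
    have h1 : ϱ x y ≤ c * ρ x y := by
      have := (hcomp x y).1
      rwa [inv_mul_le_iff₀ hc0] at this
    have h2 := hϱs x y
    have h3 : ϱ x y ≤ C₀ * ϱ x y := le_mul_of_one_le_left (hϱ0 x y) hC₀
    have h4 : C₀ * ϱ x y ≤ C₀ * (c * ρ x y) := by gcongr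
    rw [mul_assoc]
    exact max_le (h3.trans h4) (h2.trans h4)
  refine ⟨m, max ((C₀ * c) ^ α) (4 * c ^ α), le_max_of_le_left (Real.one_le_rpow hCc hα0.le),
    fun x y => ⟨?_, ?_⟩⟩
  · refine (hm x y).1.trans ((Real.rpow_le_rpow (hm0 x y) (hle1 x y) hα0.le).trans ?_)
    rw [Real.mul_rpow (by linarith) (hρ0 x y)]
    exact mul_le_mul_of_nonneg_right (le_max_left _ _) (Real.rpow_nonneg (hρ0 x y) _)
  · have h1 : ρ x y ≤ c * max (ϱ x y) (ϱ y x) :=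
      (hcomp x y).2.trans (by gcongr; exact le_max_left _ _)
    calc ρ x y ^ α ≤ (c * max (ϱ x y) (ϱ y x)) ^ α := Real.rpow_le_rpow (hρ0 x y) h1 hα0.le
      _ = c ^ α * max (ϱ x y) (ϱ y x) ^ α := Real.mul_rpow hc0.le (hm0 x y)
      _ ≤ c ^ α * (4 * dist x y) := by gcongr; exact (hm x y).2
      _ = (4 * c ^ α) * dist x y := by ring
      _ ≤ _ := by gcongr; exact le_max_right _ _

section Comparison

variable {X : Type*} [PseudoMetricSpace X] {ρ : X → X → ℝ} {α c : ℝ}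

theorem qball_subset_ball (hρ0 : ∀ x y, 0 ≤ ρ x y) (hα : 0 < α) (hc : 1 ≤ c)
    (hcomp : ∀ x y, dist x y ≤ c * ρ x y ^ α ∧ ρ x y ^ α ≤ c * dist x y) (x : X) {r : ℝ}
    (hr : 0 < r) : qball ρ x ((r / c) ^ (1 / α)) ⊆ Metric.ball x r := by
  intro y hy
  have hc0 : 0 < c := by linarith
  have h := Real.rpow_lt_rpow (hρ0 x y) hy hα
  rw [← Real.rpow_mul (by positivity), one_div_mul_cancel hα.ne', Real.rpow_one,
    lt_div_iff₀ hc0] at h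
  rw [Metric.mem_ball, dist_comm]
  linarith [(hcomp x y).1]

theorem ball_subset_qball (hρ0 : ∀ x y, 0 ≤ ρ x y) (hα : 0 < α) (hc : 1 ≤ c)
    (hcomp : ∀ x y, dist x y ≤ c * ρ x y ^ α ∧ ρ x y ^ α ≤ c * dist x y) (x : X) {r : ℝ} :
    Metric.ball x r ⊆ qball ρ x ((c * r) ^ (1 / α)) := by
  intro y hy
  have hc0 : 0 < c := by linarith
  rw [Metric.mem_ball, dist_comm] at hy
  have h : ρ x y ^ α < c * r := (hcomp x y).2.trans_lt (by gcongr)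
  have h' := Real.rpow_lt_rpow (Real.rpow_nonneg (hρ0 x y) _) h (z := 1 / α) (by positivity)
  rwa [← Real.rpow_mul (hρ0 x y), mul_one_div_cancel hα.ne', Real.rpow_one] at h'

theorem opensMeasurableSpace_of_balls [MeasurableSpace X] {μ : Measure X} (hX : IsQMMS ρ μ)
    (hα : 0 < α) (hc : 1 ≤ c)
    (hcomp : ∀ x y, dist x y ≤ c * ρ x y ^ α ∧ ρ x y ^ α ≤ c * dist x y) :
    OpensMeasurableSpace X := by
  have hc0 : 0 < c := by linarith
  obtain ⟨x₀, -, -⟩ := hX.nontrivial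
  have hσ : SigmaFinite μ := by
    refine ⟨⟨⟨fun n : ℕ => qball ρ x₀ (n + 1), fun _ => trivial,
      fun n => hX.ball_lt_top _ _ (by positivity), ?_⟩⟩⟩
    refine eq_univ_of_forall fun y => mem_iUnion.2 ?_
    obtain ⟨n, hn⟩ := exists_nat_gt (ρ x₀ y)
    exact ⟨n, by simp only [qball, mem_ofPred_eq]; linarith⟩
  have hsc : SecondCountableTopology X := by
    refine Metric.secondCountable_of_almost_dense_set fun ε hε => ?_
    obtain ⟨S, -, hS⟩ := zorn_subset_nonempty {S : Set X | S.Pairwise fun x y => ε < dist x y}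
      (fun C hC hchain _ => ⟨⋃₀ C,
        (pairwise_sUnion hchain.directedOn).2 fun s hs => hC hs, fun s => subset_sUnion_of_mem⟩)
      ∅ (pairwise_empty _)
    refine ⟨S, ?_, fun x => ?_⟩
    · have hr : 0 < (ε / 2 / c) ^ (1 / α) := by positivity
      have hcount := Measure.countable_meas_pos_of_disjoint_iUnion (μ := μ)
        (As := fun x : S => qball ρ (x : X) ((ε / 2 / c) ^ (1 / α)))
        (fun x => hX.measurableSet_ball _ _ hr) (fun x y hxy => by
          refine Disjoint.mono (qball_subset_ball hX.quasi.1 hα hc hcomp _ (by positivity))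
            (qball_subset_ball hX.quasi.1 hα hc hcomp _ (by positivity))
            (Metric.ball_disjoint_ball ?_)
          have := hS.prop x.2 y.2 (fun h => hxy (Subtype.ext h))
          linarith)
      have huniv : {x : S | 0 < μ (qball ρ (x : X) ((ε / 2 / c) ^ (1 / α)))} = univ :=
        eq_univ_of_forall fun x => hX.ball_pos _ _ hr
      rw [huniv] at hcount
      exact countable_coe_iff.1 (countable_univ_iff.1 hcount)
    · by_contra! hx
      have hins : (insert x S).Pairwise fun x y => ε < dist x y :=
        hS.prop.insert fun y hy _ => ⟨hx y hy, by rw [dist_comm]; exact hx y hy⟩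
      have hxS : x ∈ S := hS.le_of_ge hins (subset_insert x S) (mem_insert x S)
      have := hx x hxS
      rw [dist_self] at this
      linarith
  refine ⟨MeasurableSpace.generateFrom_le fun U (hU : IsOpen U) => ?_⟩
  have hex : ∀ x : U, ∃ r : ℝ, 0 < r ∧ Metric.ball (x : X) r ⊆ U :=
    fun x => Metric.isOpen_iff.1 hU x x.2
  choose r hr hrU using hex
  have hδ : ∀ x : U, 0 < (r x / c) ^ (1 / α) := fun x => by have := hr x; positivity
  have hδ' : ∀ x : U, 0 < ((r x / c) ^ (1 / α)) ^ α / c := fun x => by have := hδ x; positivity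
  obtain ⟨T, hT, hTU⟩ := TopologicalSpace.isOpen_iUnion_countable
    (fun x : U => Metric.ball (x : X) (((r x / c) ^ (1 / α)) ^ α / c)) fun x => Metric.isOpen_ball
  have hUeq : U = ⋃ x ∈ T, qball ρ (x : X) ((r x / c) ^ (1 / α)) := by
    apply subset_antisymm
    · intro y hy
      have hy' : y ∈ ⋃ x : U, Metric.ball (x : X) (((r x / c) ^ (1 / α)) ^ α / c) :=
        mem_iUnion.2 ⟨⟨y, hy⟩, Metric.mem_ball_self (hδ' _)⟩
      rw [← hTU] at hy'
      refine iUnion₂_mono (fun x _ => ?_) hy'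
      refine (ball_subset_qball hX.quasi.1 hα hc hcomp _).trans (le_of_eq ?_)
      rw [mul_div_cancel₀ _ hc0.ne', ← Real.rpow_mul (hδ x).le, mul_one_div_cancel hα.ne',
        Real.rpow_one]
    · exact iUnion₂_subset fun x _ =>
        (qball_subset_ball hX.quasi.1 hα hc hcomp _ (hr x)).trans (hrU x)
  rw [hUeq]
  exact MeasurableSet.biUnion hT fun x _ => hX.measurableSet_ball _ _ (hδ x)

end Comparison

theorem measure_level_le {X : Type*} [MeasurableSpace X] {μ : Measure X} {h : X → ℝ≥0∞}
    (hh : AEMeasurable h μ) {p m N : ℝ} (hp : 0 < p)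
    (hint : ∫⁻ y, h y ^ p ∂μ ≤ ENNReal.ofReal (N ^ p * m / 2)) {L a : ℝ} (hL : 0 < L)
    (ha : L ^ p * a = N ^ p) : μ {y | ENNReal.ofReal L < h y} ≤ ENNReal.ofReal (a * m / 2) := by
  have h1 := (mul_meas_ge_le_lintegral₀ (hh.pow_const p) (ENNReal.ofReal (L ^ p))).trans hint
  have hLp : 0 < L ^ p := by positivity
  rw [← ha, show L ^ p * a * m / 2 = L ^ p * (a * m / 2) by ring,
    ENNReal.ofReal_mul hLp.le] at h1
  refine (measure_mono fun y hy => ?_).trans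
    ((ENNReal.mul_le_mul_iff_right (by simpa using hLp) ENNReal.ofReal_ne_top).1 h1)
  change ENNReal.ofReal (L ^ p) ≤ h y ^ p
  rw [← ENNReal.ofReal_rpow_of_pos hL]
  exact ENNReal.rpow_le_rpow (le_of_lt hy) hp.le

/-- A Sobolev-type capacity estimate: a function with generalized gradient `h` that oscillates by
at least one between two sets of measure `m` must have a gradient with large `L^p` norm. -/
theorem capacity_bound {X : Type*} [PseudoMetricSpace X] [MeasurableSpace X] {σ p Q A : ℝ}
    (hσ : 0 < σ) (hp : 0 < p) (hA : 0 < A) (hlt : σ * p < Q) :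
    ∃ C : ℝ, 0 < C ∧ ∀ (μ : Measure X) (x : X) (R b m N : ℝ) (v : X → ℝ) (h : X → ℝ≥0∞)
      (E S S' : Set X), 0 ≤ R → 0 < b → 0 < m → 0 < N →
      (∀ y r, dist x y ≤ 3 * R → 0 < r → r ≤ R →
        ENNReal.ofReal (b * r ^ Q) ≤ μ (Metric.ball y r)) →
      AEMeasurable h μ → ∫⁻ y, h y ^ p ∂μ ≤ ENNReal.ofReal (N ^ p * m / 2) → μ E = 0 →
      (∀ y ∉ E, ∀ z ∉ E, ∀ l : ℝ, 0 ≤ l → h y ≤ ENNReal.ofReal l → h z ≤ ENNReal.ofReal l →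
        |v y - v z| ≤ A * dist y z ^ σ * l) →
      S ⊆ Metric.closedBall x R → S' ⊆ Metric.closedBall x R →
      ENNReal.ofReal m ≤ μ S → ENNReal.ofReal m ≤ μ S' →
      (∀ y ∈ S, ∀ z ∈ S', 1 ≤ |v y - v z|) → 1 ≤ C * N * ((m / b) ^ (1 / Q)) ^ σ := by
  have hQ : 0 < Q := by nlinarith [mul_pos hσ hp]
  set w : ℝ := 2 ^ (-(Q / p)) with hw
  have hw0 : 0 < w := by positivity
  have hw1 : w ≤ 1 := by
    rw [hw]
    exact Real.rpow_le_one_of_one_le_of_nonpos (by norm_num) (by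
      have : 0 < Q / p := by positivity
      linarith)
  have hwp : w ^ p * 2 ^ Q = 1 := by
    rw [hw, ← Real.rpow_mul (by norm_num), ← Real.rpow_add (by norm_num)]
    field_simp
    simp
  set θ : ℝ := 2 ^ σ * w with hθ
  have hθ0 : 0 < θ := by positivity
  have hθ1 : θ < 1 := by
    rw [hθ, hw, ← Real.rpow_add (by norm_num)]
    refine Real.rpow_lt_one_of_one_lt_of_neg (by norm_num) ?_
    have : σ < Q / p := by rwa [lt_div_iff₀ hp]
    linarith
  have h1θ : 0 < 1 - θ := by linarith
  refine ⟨A * (2 * 2 ^ σ / (1 - θ) + 12 ^ σ), by positivity, ?_⟩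
  intro μ x R b m N v h E S S' hR hb hm hN hball hh hint hE hv hS hS' hmS hmS' hsep
  set t₀ : ℝ := (m / b) ^ (1 / Q) with ht₀
  have ht₀0 : 0 < t₀ := by positivity
  have ht₀Q : b * t₀ ^ Q = m := by
    rw [ht₀, ← Real.rpow_mul (by positivity), one_div_mul_cancel hQ.ne', Real.rpow_one]
    field_simp
  set t : ℕ → ℝ := fun i => t₀ * 2 ^ i with ht
  have ht0 : ∀ i, 0 < t i := fun i => by positivity
  have hpow : ∀ (e : ℝ) (i : ℕ), ((2 : ℝ) ^ i) ^ e = (2 ^ e) ^ i := fun e i => by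
    rw [← Real.rpow_natCast, ← Real.rpow_natCast, ← Real.rpow_mul (by norm_num),
      ← Real.rpow_mul (by norm_num), mul_comm]
  have htQ : ∀ i, b * t i ^ Q = m * (2 ^ Q) ^ i := by
    intro i
    simp only [ht]
    rw [Real.mul_rpow ht₀0.le (by positivity), ← mul_assoc, ht₀Q, hpow]
  have htσ : ∀ i, t i ^ σ = t₀ ^ σ * (2 ^ σ) ^ i := by
    intro i
    simp only [ht]
    rw [Real.mul_rpow ht₀0.le (by positivity), hpow]
  have hts : ∀ i, t (i + 1) = 2 * t i := fun i => by simp only [ht]; ring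
  set lev : ℕ → ℝ := fun i => N * w ^ i with hlev
  have hlev0 : ∀ i, 0 < lev i := fun i => by positivity
  have hlevs : ∀ i, lev (i + 1) ≤ lev i := fun i => by
    simp only [hlev]
    exact mul_le_mul_of_nonneg_left (pow_le_pow_of_le_one hw0.le hw1 (Nat.le_succ i)) hN.le
  set bad : ℕ → Set X := fun i => {y | ENNReal.ofReal (lev i) < h y} ∪ E with hbad
  have hbadm : ∀ i, μ (bad i) ≤ ENNReal.ofReal ((2 ^ Q) ^ i * m / 2) := by
    intro i
    refine (measure_union_le _ _).trans ?_
    rw [hE, add_zero]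
    refine measure_level_le hh hp hint (hlev0 i) ?_
    simp only [hlev]
    rw [Real.mul_rpow hN.le (by positivity), mul_assoc, ← Real.rpow_natCast w i,
      ← Real.rpow_mul hw0.le, mul_comm (i : ℝ) p, Real.rpow_mul hw0.le, Real.rpow_natCast,
      ← mul_pow, hwp, one_pow, mul_one]
  have hgood : ∀ i y, y ∉ bad i → h y ≤ ENNReal.ofReal (lev i) ∧ y ∉ E := by
    intro i y hy
    simp only [hbad, mem_union, mem_ofPred_eq, not_or, not_lt] at hy
    exact hy
  have hexists : ∀ i (B : Set X), ENNReal.ofReal ((2 ^ Q) ^ i * m) ≤ μ B →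
      ∃ y ∈ B, y ∉ bad i := by
    intro i B hB
    by_contra! hcon
    have h1 := hB.trans ((measure_mono hcon).trans (hbadm i))
    rw [ENNReal.ofReal_le_ofReal_iff (by positivity)] at h1
    have : 0 < ((2 : ℝ) ^ Q) ^ i * m := by positivity
    linarith
  have hvl : ∀ i y z D, y ∉ bad i → z ∉ bad i → dist y z ≤ D →
      |v y - v z| ≤ A * D ^ σ * lev i := by
    intro i y z D hy hz hD
    refine (hv y (hgood i y hy).2 z (hgood i z hz).2 (lev i) (hlev0 i).le (hgood i y hy).1
      (hgood i z hz).1).trans ?_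
    have := hlev0 i
    gcongr
  set K : ℝ := A * N * t₀ ^ σ * 2 ^ σ with hK
  have hK0 : 0 < K := by positivity
  have hchain : ∀ a, a ∉ bad 0 → dist x a ≤ R → ∀ i, t i ≤ R → ∃ y, y ∉ bad i ∧
      dist a y ≤ 2 * t i ∧ |v a - v y| ≤ K * ∑ j ∈ Finset.range i, θ ^ j := by
    intro a ha hxa i
    induction i with
    | zero =>
      intro _
      exact ⟨a, ha, by rw [dist_self]; linarith [ht0 0], by simp⟩
    | succ i ih =>
      intro hi
      have hti := ht0 i
      have hii := hts i
      obtain ⟨y, hy, hay, hvy⟩ := ih (by linarith)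
      have hxy : dist x y ≤ 3 * R := by linarith [dist_triangle x a y]
      obtain ⟨z, hz, hzb⟩ := hexists (i + 1) (Metric.ball y (t (i + 1))) (by
        rw [mul_comm, ← htQ]
        exact hball y _ hxy (ht0 _) hi)
      rw [Metric.mem_ball, dist_comm] at hz
      have hzb' : z ∉ bad i := by
        intro hzi
        refine hzb ?_
        rcases hzi with hzi | hzi
        · exact Or.inl (lt_of_le_of_lt (ENNReal.ofReal_le_ofReal (hlevs i)) hzi)
        · exact Or.inr hzi
      refine ⟨z, hzb, by linarith [dist_triangle a y z], ?_⟩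
      have h1 := hvl i y z (t (i + 1)) hy hzb' hz.le
      have h2 : A * t (i + 1) ^ σ * lev i = K * θ ^ i := by
        rw [htσ]
        simp only [hlev, hK, hθ]
        ring
      rw [Finset.sum_range_succ, mul_add, ← h2]
      exact (abs_sub_le _ _ _).trans (add_le_add hvy h1)
  have hsum : ∀ i, ∑ j ∈ Finset.range i, θ ^ j ≤ 1 / (1 - θ) := by
    intro i
    rw [one_div, ← tsum_geometric_of_lt_one hθ0.le hθ1]
    exact (summable_geometric_of_lt_one hθ0.le hθ1).sum_le_tsum _ fun _ _ => by positivity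
  obtain ⟨a, haS, ha⟩ := hexists 0 S (by simpa using hmS)
  obtain ⟨a', haS', ha'⟩ := hexists 0 S' (by simpa using hmS')
  have hxa : dist x a ≤ R := by have := hS haS; rwa [Metric.mem_closedBall, dist_comm] at this
  have hxa' : dist x a' ≤ R := by
    have := hS' haS'; rwa [Metric.mem_closedBall, dist_comm] at this
  have haa' : dist a a' ≤ 2 * R := by
    have := dist_triangle a x a'; rw [dist_comm a x] at this; linarith
  refine (hsep a haS a' haS').trans ?_
  have hfin : A * (2 * 2 ^ σ / (1 - θ) + 12 ^ σ) * N * t₀ ^ σ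
      = K * (1 / (1 - θ)) + K * (1 / (1 - θ)) + A * 12 ^ σ * N * t₀ ^ σ := by
    simp only [hK]; field_simp
    ring
  rw [hfin]
  have hKθ : 0 < K * (1 / (1 - θ)) := by positivity
  have hlarge : ∃ n, R < t n := by
    obtain ⟨n, hn⟩ := pow_unbounded_of_one_lt (R / t₀) (one_lt_two)
    exact ⟨n, by rw [div_lt_iff₀ ht₀0] at hn; simp only [ht]; linarith⟩
  classical
  obtain ⟨k, hk⟩ : ∃ k, Nat.find hlarge = k := ⟨_, rfl⟩
  have hkR : R < t k := hk ▸ Nat.find_spec hlarge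
  cases k with
  | zero =>
    have h1 := hvl 0 a a' (12 * t₀) ha ha' (by simp only [ht] at hkR; linarith)
    rw [Real.mul_rpow (by norm_num) ht₀0.le] at h1
    simp only [hlev, pow_zero, mul_one] at h1
    linarith
  | succ n =>
    have hnR : t n ≤ R := not_lt.1 (Nat.find_min hlarge (by omega))
    obtain ⟨y, hy, hay, hvy⟩ := hchain a ha hxa n hnR
    obtain ⟨y', hy', hay', hvy'⟩ := hchain a' ha' hxa' n hnR
    have hyy' : dist y y' ≤ 12 * t n := by
      have h1 := dist_triangle4 y a a' y'
      rw [dist_comm y a] at h1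
      linarith [hts n]
    have h1 := hvl n y y' _ hy hy' hyy'
    have h2 : A * (12 * t n) ^ σ * lev n ≤ A * 12 ^ σ * N * t₀ ^ σ := by
      rw [Real.mul_rpow (by norm_num) (ht0 n).le, htσ]
      calc A * (12 ^ σ * (t₀ ^ σ * (2 ^ σ) ^ n)) * lev n
          = A * 12 ^ σ * N * t₀ ^ σ * θ ^ n := by simp only [hlev, hθ]; ring
        _ ≤ A * 12 ^ σ * N * t₀ ^ σ * 1 := by
          gcongr
          exact pow_le_one₀ hθ0.le hθ1.le
        _ = _ := mul_one _
    have h3 : ∀ i, K * ∑ j ∈ Finset.range i, θ ^ j ≤ K * (1 / (1 - θ)) :=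
      fun i => mul_le_mul_of_nonneg_left (hsum i) hK0.le
    have h4 := abs_sub_le (v a) (v y) (v a')
    have h5 := abs_sub_le (v y) (v y') (v a')
    rw [abs_sub_comm (v y') (v a')] at h5
    linarith [h3 n]

section HalfRadius

variable {X : Type*} [PseudoMetricSpace X] [MeasurableSpace X] [OpensMeasurableSpace X]

/-- A radius `t` at which the measure of concentric balls crosses half of `ν (ball x r)`. -/
theorem exists_half_radius (ν : Measure X) (x : X) (hfin : ∀ r, ν (Metric.ball x r) < ∞)
    {r : ℝ} (hr : 0 < r) (hpos : 0 < ν (Metric.ball x r)) :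
    ∃ t, 0 ≤ t ∧ t < r ∧ ν (Metric.ball x t) ≤ ν (Metric.ball x r) / 2 ∧
      ν (Metric.ball x r) / 2 ≤ ν (Metric.closedBall x t) ∧
      ∀ η, 0 ≤ η → η ≤ r → ν (Metric.ball x η) ≤ ν (Metric.ball x r) / 2 → η ≤ t := by
  set S : Set ℝ := {t | 0 ≤ t ∧ t ≤ r ∧ ν (Metric.ball x t) ≤ ν (Metric.ball x r) / 2} with hS
  have hbdd : BddAbove S := ⟨r, fun t ht => ht.2.1⟩
  have h0S : (0 : ℝ) ∈ S := ⟨le_rfl, hr.le, by simp⟩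
  have hne : S.Nonempty := ⟨0, h0S⟩
  have ht0 : 0 ≤ sSup S := le_csSup hbdd h0S
  have htr : sSup S ≤ r := csSup_le hne fun t ht => ht.2.1
  have hhalf : ν (Metric.ball x (sSup S)) ≤ ν (Metric.ball x r) / 2 := by
    have hun : Metric.ball x (sSup S) = ⋃ n : ℕ, Metric.ball x (sSup S - 1 / ((n : ℝ) + 1)) := by
      ext y
      simp only [Metric.mem_ball, mem_iUnion]
      constructor
      · intro hy
        obtain ⟨n, hn⟩ := exists_nat_one_div_lt (sub_pos.2 hy)
        exact ⟨n, by linarith⟩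
      · rintro ⟨n, hn⟩
        have : (0 : ℝ) < 1 / ((n : ℝ) + 1) := by positivity
        linarith
    have hmono : Monotone fun n : ℕ => Metric.ball x (sSup S - 1 / ((n : ℝ) + 1)) := by
      intro n m hnm
      refine Metric.ball_subset_ball ?_
      have : 1 / ((m : ℝ) + 1) ≤ 1 / ((n : ℝ) + 1) := Nat.one_div_le_one_div hnm
      linarith
    rw [hun, hmono.measure_iUnion]
    refine iSup_le fun n => ?_
    have hn : (0 : ℝ) < 1 / ((n : ℝ) + 1) := by positivity
    obtain ⟨t, htS, ht⟩ := exists_lt_of_lt_csSup hne (show sSup S - 1 / ((n : ℝ) + 1) < sSup S by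
      linarith)
    exact (measure_mono (Metric.ball_subset_ball ht.le)).trans htS.2.2
  have hlt : sSup S < r := by
    refine lt_of_le_of_ne htr fun h => ?_
    rw [h] at hhalf
    exact absurd hhalf (not_le.2 (ENNReal.half_lt_self hpos.ne' (hfin r).ne))
  refine ⟨sSup S, ht0, hlt, hhalf, ?_, fun η h1 h2 h3 => le_csSup hbdd ⟨h1, h2, h3⟩⟩
  have hint : Metric.closedBall x (sSup S)
      = ⋂ n : ℕ, Metric.ball x (sSup S + 1 / ((n : ℝ) + 1)) := by
    ext y
    simp only [Metric.mem_ball, Metric.mem_closedBall, mem_iInter]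
    constructor
    · intro hy n
      have : (0 : ℝ) < 1 / ((n : ℝ) + 1) := by positivity
      linarith
    · intro h
      refine le_of_forall_pos_lt_add fun ε hε => ?_
      obtain ⟨n, hn⟩ := exists_nat_one_div_lt hε
      linarith [h n]
  have hanti : Antitone fun n : ℕ => Metric.ball x (sSup S + 1 / ((n : ℝ) + 1)) := by
    intro n m hnm
    refine Metric.ball_subset_ball ?_
    have : 1 / ((m : ℝ) + 1) ≤ 1 / ((n : ℝ) + 1) := Nat.one_div_le_one_div hnm
    linarith
  rw [hint, hanti.measure_iInter (fun n => Metric.isOpen_ball.measurableSet.nullMeasurableSet)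
    ⟨0, (hfin _).ne⟩]
  refine le_iInf fun n => ?_
  by_contra! hcon
  have hn : (0 : ℝ) < 1 / ((n : ℝ) + 1) := by positivity
  have hmem : min (sSup S + 1 / ((n : ℝ) + 1)) r ∈ S :=
    ⟨le_min (by linarith) hr.le, min_le_right _ _,
      (measure_mono (Metric.ball_subset_ball (min_le_left _ _))).trans hcon.le⟩
  have := le_csSup hbdd hmem
  rcases min_le_iff.1 this with h | h <;> linarith

theorem le_of_halving_iterates {f φ : ℝ → ℝ} {r K e : ℝ} (hr : 0 < r) (he : 0 < e) (hK : 0 ≤ K)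
    (hf0 : ∀ t, 0 ≤ f t) (hpos : ∀ t, 0 < t → 0 < f t) (hmono : Monotone f)
    (hφ : ∀ t, 0 ≤ t → t ≤ r → 0 ≤ φ t ∧ φ t ≤ t ∧ f (φ t) ≤ f t / 2)
    (hstep : ∀ t, 0 ≤ t → t ≤ r → φ t - φ (φ t) ≤ K * f t ^ e) :
    φ r ≤ K / (1 - 2⁻¹ ^ e) * f r ^ e := by
  set w : ℝ := 2⁻¹ ^ e with hw
  have hw0 : 0 < w := by positivity
  have hw1 : w < 1 := Real.rpow_lt_one (by norm_num) (by norm_num) he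
  have h1w : 0 < 1 - w := by linarith
  have hiter : ∀ n : ℕ, 0 ≤ φ^[n] r ∧ φ^[n] r ≤ r ∧ f (φ^[n] r) ≤ 2⁻¹ ^ n * f r := by
    intro n
    induction n with
    | zero => simp [hr.le]
    | succ n ih =>
      rw [Function.iterate_succ_apply']
      obtain ⟨h1, h2, h3⟩ := hφ _ ih.1 ih.2.1
      refine ⟨h1, h2.trans ih.2.1, h3.trans ?_⟩
      rw [pow_succ]
      linarith [ih.2.2]
  have hsum : ∀ n : ℕ, φ r ≤ K * f r ^ e * ∑ j ∈ Finset.range n, w ^ j + φ^[n + 1] r := by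
    intro n
    induction n with
    | zero => simp
    | succ n ih =>
      obtain ⟨h1, h2, h3⟩ := hiter n
      have h4 := hstep _ h1 h2
      rw [← Function.iterate_succ_apply' φ, ← Function.iterate_succ_apply' φ] at h4
      have h5 : f (φ^[n] r) ^ e ≤ w ^ n * f r ^ e := by
        refine (Real.rpow_le_rpow (hf0 _) h3 he.le).trans (le_of_eq ?_)
        rw [Real.mul_rpow (by positivity) (hf0 r), hw, ← Real.rpow_natCast, ← Real.rpow_natCast,
          ← Real.rpow_mul (by norm_num), ← Real.rpow_mul (by norm_num), mul_comm e]
      have h6 := mul_le_mul_of_nonneg_left h5 hK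
      rw [Finset.sum_range_succ, mul_add]
      linarith
  refine le_of_forall_pos_le_add fun ε hε => ?_
  obtain ⟨n, hn⟩ : ∃ n : ℕ, 2⁻¹ ^ n * f r < f ε := by
    obtain ⟨n, hn⟩ := exists_pow_lt_of_lt_one (div_pos (hpos ε hε) (hpos r hr))
      (show (2⁻¹ : ℝ) < 1 by norm_num)
    exact ⟨n, (lt_div_iff₀ (hpos r hr)).1 hn⟩
  have hn' : φ^[n + 1] r < ε := by
    have h1 : φ^[n + 1] r ≤ φ^[n] r := by
      rw [Function.iterate_succ_apply']
      exact (hφ _ (hiter n).1 (hiter n).2.1).2.1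
    refine h1.trans_lt ?_
    by_contra! hcon
    linarith [hmono hcon, (hiter n).2.2]
  have hgeom : ∑ j ∈ Finset.range n, w ^ j ≤ 1 / (1 - w) := by
    rw [one_div, ← tsum_geometric_of_lt_one hw0.le hw1]
    exact (summable_geometric_of_lt_one hw0.le hw1).sum_le_tsum _ fun _ _ => by positivity
  have hKf : 0 ≤ K * f r ^ e := mul_nonneg hK (Real.rpow_nonneg (hf0 r) _)
  have h7 := mul_le_mul_of_nonneg_left hgeom hKf
  have h8 : K / (1 - w) * f r ^ e = K * f r ^ e * (1 / (1 - w)) := by ring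
  linarith [hsum n]

variable {μ : Measure X} {Ω : Set X} {κ Q K lam : ℝ}

theorem density_of_thin_center (hΩ : MeasurableSet Ω)
    (hpos : ∀ x ∈ Ω, ∀ r, 0 < r → 0 < μ (Metric.ball x r ∩ Ω))
    (hfin : ∀ x r, μ (Metric.ball x r) < ∞) (hQ : 0 < Q) (hK : 0 < K)
    (hstep : ∀ x ∈ Ω, ∀ R r' r'', 0 < R → R ≤ 1 → 0 ≤ r' → r' < r'' → r'' < R →
      μ (Metric.ball x r'' ∩ Ω) / 2 ≤ μ (Metric.closedBall x r' ∩ Ω) →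
      μ (Metric.ball x r'' ∩ Ω) / 2 ≤ μ ((Metric.ball x R \ Metric.ball x r'') ∩ Ω) →
      r'' - r' ≤ K * R * (μ.real (Metric.ball x r'' ∩ Ω) / μ.real (Metric.ball x R)) ^ (1 / Q))
    {η : ℝ} (hη : 0 < η) (hη1 : η ≤ 1) :
    ∃ c : ℝ, 0 < c ∧ ∀ x ∈ Ω, ∀ r, 0 < r → r ≤ 1 →
      μ (Metric.ball x (η * r) ∩ Ω) ≤ μ (Metric.ball x r ∩ Ω) / 2 →
      c * μ.real (Metric.ball x r) ≤ μ.real (Metric.ball x r ∩ Ω) := by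
  have hw1 : (2⁻¹ : ℝ) ^ (1 / Q) < 1 := Real.rpow_lt_one (by norm_num) (by norm_num) (by positivity)
  have h1w : 0 < 1 - (2⁻¹ : ℝ) ^ (1 / Q) := by linarith
  refine ⟨(η * (1 - 2⁻¹ ^ (1 / Q)) / K) ^ Q, by positivity, fun x hx r hr hr1 hthin => ?_⟩
  have hresB : ∀ t, (μ.restrict Ω) (Metric.ball x t) = μ (Metric.ball x t ∩ Ω) :=
    fun t => Measure.restrict_apply' hΩ
  have hresC : ∀ t, (μ.restrict Ω) (Metric.closedBall x t) = μ (Metric.closedBall x t ∩ Ω) :=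
    fun t => Measure.restrict_apply' hΩ
  have hfinΩ : ∀ t, μ (Metric.ball x t ∩ Ω) < ∞ :=
    fun t => (measure_mono inter_subset_left).trans_lt (hfin x t)
  have hex : ∀ t : ℝ, ∃ y : ℝ, (t ≤ 0 → y = 0) ∧ (0 < t → 0 ≤ y ∧ y < t ∧
      μ (Metric.ball x y ∩ Ω) ≤ μ (Metric.ball x t ∩ Ω) / 2 ∧
      μ (Metric.ball x t ∩ Ω) / 2 ≤ μ (Metric.closedBall x y ∩ Ω) ∧
      ∀ δ, 0 ≤ δ → δ ≤ t → μ (Metric.ball x δ ∩ Ω) ≤ μ (Metric.ball x t ∩ Ω) / 2 → δ ≤ y) := by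
    intro t
    rcases le_or_gt t 0 with ht | ht
    · exact ⟨0, fun _ => rfl, fun h => absurd h (not_lt.2 ht)⟩
    · obtain ⟨y, hy⟩ := exists_half_radius (μ.restrict Ω) x (fun t => by rw [hresB]; exact hfinΩ t)
        ht (by rw [hresB]; exact hpos x hx t ht)
      simp only [hresB, hresC] at hy
      exact ⟨y, fun h => absurd h (not_le.2 ht), fun _ => hy⟩
  choose φ hφ0 hφ using hex
  set f : ℝ → ℝ := fun t => μ.real (Metric.ball x t ∩ Ω) with hf
  have hfmono : Monotone f := fun a b hab => measureReal_mono
    (inter_subset_inter_left _ (Metric.ball_subset_ball hab)) (hfinΩ b).ne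
  have hfpos : ∀ t, 0 < t → 0 < f t := fun t ht =>
    ENNReal.toReal_pos (hpos x hx t ht).ne' (hfinΩ t).ne
  have hφz : φ 0 = 0 := hφ0 0 le_rfl
  have hV : 0 < μ.real (Metric.ball x r) :=
    (hfpos r hr).trans_le (measureReal_mono inter_subset_left (hfin x r).ne)
  set V := μ.real (Metric.ball x r) with hVdef
  have hbound := le_of_halving_iterates (f := f) (φ := φ) (r := r) (K := K * r * (1 / V) ^ (1 / Q))
    (e := 1 / Q) hr (by positivity) (by positivity) (fun t => measureReal_nonneg) hfpos hfmono
    (fun t ht htr => by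
      rcases ht.eq_or_lt with rfl | ht'
      · rw [hφz]; simp [hf]
      · obtain ⟨h1, h2, h3, -⟩ := hφ t ht'
        refine ⟨h1, h2.le, ?_⟩
        have := ENNReal.toReal_mono (ENNReal.div_ne_top (hfinΩ t).ne (by norm_num)) h3
        rwa [ENNReal.toReal_div] at this)
    (fun t ht htr => by
      have hrhs : ∀ a, 0 ≤ a → K * r * (a / V) ^ (1 / Q) = K * r * (1 / V) ^ (1 / Q) * a ^ (1 / Q) := by
        intro a ha
        rw [mul_assoc (K * r), ← Real.mul_rpow (by positivity) ha, one_div_mul_eq_div]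
      rcases ht.eq_or_lt with rfl | ht'
      · rw [hφz, hφz, sub_zero]
        exact mul_nonneg (by positivity) (Real.rpow_nonneg measureReal_nonneg _)
      obtain ⟨h1, h2, h3, h4, -⟩ := hφ t ht'
      rcases h1.eq_or_lt with h1 | h1
      · rw [← h1, hφz, sub_zero]
        exact mul_nonneg (by positivity) (Real.rpow_nonneg measureReal_nonneg _)
      obtain ⟨g1, g2, g3, g4, -⟩ := hφ (φ t) h1
      have hle : μ (Metric.ball x (φ t) ∩ Ω) ≤ μ (Metric.ball x t ∩ Ω) :=
        measure_mono (inter_subset_inter_left _ (Metric.ball_subset_ball h2.le))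
      refine (hstep x hx r _ _ hr hr1 g1 g2 (h2.trans_le htr) g4 ?_).trans ?_
      · have hsub : μ (Metric.ball x t ∩ Ω) ≤ μ (Metric.ball x (φ t) ∩ Ω)
            + μ ((Metric.ball x r \ Metric.ball x (φ t)) ∩ Ω) := by
          refine (measure_mono ?_).trans (measure_union_le _ _)
          rintro y ⟨hy, hyΩ⟩
          by_cases hy' : y ∈ Metric.ball x (φ t)
          · exact Or.inl ⟨hy', hyΩ⟩
          · exact Or.inr ⟨⟨Metric.ball_subset_ball htr hy, hy'⟩, hyΩ⟩
        have h5 : μ (Metric.ball x t ∩ Ω) / 2 + μ (Metric.ball x t ∩ Ω) / 2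
            ≤ μ (Metric.ball x t ∩ Ω) / 2
              + μ ((Metric.ball x r \ Metric.ball x (φ t)) ∩ Ω) := by
          rw [ENNReal.add_halves]
          exact hsub.trans (by gcongr)
        have h6 := (ENNReal.add_le_add_iff_left
          (ENNReal.div_ne_top (hfinΩ t).ne (by norm_num))).1 h5
        exact (ENNReal.div_le_div_right hle 2).trans h6
      · rw [hrhs _ measureReal_nonneg]
        gcongr
        exact hfmono h2.le)
  have hηφ : η * r ≤ φ r :=
    (hφ r hr).2.2.2.2 _ (by positivity) (mul_le_of_le_one_left hr.le hη1) hthin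
  have h7 : η * (1 - 2⁻¹ ^ (1 / Q)) / K ≤ (f r / V) ^ (1 / Q) := by
    have h8 := hηφ.trans hbound
    rw [div_mul_eq_mul_div, le_div_iff₀ h1w, mul_assoc (K * r),
      ← Real.mul_rpow (by positivity) (hfpos r hr).le, one_div_mul_eq_div] at h8
    rw [div_le_iff₀ hK]
    refine le_of_mul_le_mul_left (a := r) ?_ hr
    linarith
  have h9 := Real.rpow_le_rpow (by positivity) h7 hQ.le
  rwa [← Real.rpow_mul (by have := hfpos r hr; positivity), one_div_mul_cancel hQ.ne', Real.rpow_one,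
    le_div_iff₀ hV] at h9

theorem density_of_step (hΩ : MeasurableSet Ω)
    (hpos : ∀ x ∈ Ω, ∀ r, 0 < r → 0 < μ (Metric.ball x r ∩ Ω))
    (hfin : ∀ x r, μ (Metric.ball x r) < ∞) (hQ : 0 < Q) (hK : 0 < K) (hκ : 0 < κ)
    (hdoub : ∀ x y r R, 0 < r → r ≤ R → dist x y ≤ 3 * R →
      κ * (r / R) ^ Q * μ.real (Metric.ball x R) ≤ μ.real (Metric.ball y r))
    (hstep : ∀ x ∈ Ω, ∀ R r' r'', 0 < R → R ≤ 1 → 0 ≤ r' → r' < r'' → r'' < R →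
      μ (Metric.ball x r'' ∩ Ω) / 2 ≤ μ (Metric.closedBall x r' ∩ Ω) →
      μ (Metric.ball x r'' ∩ Ω) / 2 ≤ μ ((Metric.ball x R \ Metric.ball x r'') ∩ Ω) →
      r'' - r' ≤ K * R * (μ.real (Metric.ball x r'' ∩ Ω) / μ.real (Metric.ball x R)) ^ (1 / Q))
    (hlam : 0 < lam) (hlam1 : lam ≤ 1)
    (hperf : ∀ x ∈ Ω, ∀ r, 0 < r → r ≤ 1 →
      Ω ⊆ Metric.ball x r ∨ ∃ y ∈ Ω, lam * r ≤ dist x y ∧ dist x y < r) :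
    ∃ c : ℝ, 0 < c ∧ ∀ x ∈ Ω, ∀ r, 0 < r → r ≤ 1 →
      c * μ.real (Metric.ball x r) ≤ μ.real (Metric.ball x r ∩ Ω) := by
  rcases Ω.eq_empty_or_nonempty with rfl | ⟨x₀, hx₀⟩
  · exact ⟨1, one_pos, fun x hx => hx.elim⟩
  obtain ⟨c, hc, hthin⟩ := density_of_thin_center (η := lam / 8) hΩ hpos hfin hQ hK hstep
    (by positivity) (by linarith)
  have hfinΩ : ∀ x t, μ (Metric.ball x t ∩ Ω) < ∞ :=
    fun x t => (measure_mono inter_subset_left).trans_lt (hfin x t)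
  have hposr : ∀ x ∈ Ω, ∀ r, 0 < r → 0 < μ.real (Metric.ball x r ∩ Ω) := fun x hx r hr =>
    ENNReal.toReal_pos (hpos x hx r hr).ne' (hfinΩ x r).ne
  set m₀ := μ.real (Metric.ball x₀ 1 ∩ Ω) with hm₀
  set V₀ := μ.real (Metric.ball x₀ 2) with hV₀
  have hm₀0 : 0 < m₀ := hposr x₀ hx₀ 1 one_pos
  have hV₀0 : 0 < V₀ := hm₀0.trans_le (measureReal_mono (inter_subset_left.trans
    (Metric.ball_subset_ball (by norm_num))) (hfin _ _).ne)
  set c' := c * (κ * (1 / 2) ^ Q) with hc'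
  have hc'0 : 0 < c' := by positivity
  refine ⟨min c (min c' (m₀ / V₀)), by positivity, fun x hx r hr hr1 => ?_⟩
  have hVx : 0 ≤ μ.real (Metric.ball x r) := measureReal_nonneg
  by_cases hcase : μ (Metric.ball x (lam / 8 * r) ∩ Ω) ≤ μ (Metric.ball x r ∩ Ω) / 2
  · refine le_trans ?_ (hthin x hx r hr hr1 hcase)
    gcongr
    exact min_le_left _ _
  rw [not_le] at hcase
  rcases hperf x hx (r / 4) (by positivity) (by linarith) with hsub | ⟨y, hy, hy1, hy2⟩
  · have hx₀x : dist x₀ x < r / 4 := hsub hx₀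
    have h1 : μ.real (Metric.ball x r) ≤ V₀ :=
      measureReal_mono (Metric.ball_subset_ball' (by rw [dist_comm]; linarith)) (hfin _ _).ne
    have h2 : m₀ ≤ μ.real (Metric.ball x r ∩ Ω) :=
      measureReal_mono (fun z hz => ⟨Metric.ball_subset_ball (by linarith) (hsub hz.2), hz.2⟩)
        (hfinΩ _ _).ne
    calc min c (min c' (m₀ / V₀)) * μ.real (Metric.ball x r) ≤ m₀ / V₀ * V₀ := by
          gcongr
          exact (min_le_right _ _).trans (min_le_right _ _)
      _ = m₀ := by field_simp
      _ ≤ _ := h2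
  · have hsub1 : Metric.ball y (r / 2) ∩ Ω ⊆ Metric.ball x r ∩ Ω :=
      inter_subset_inter_left _ (Metric.ball_subset_ball' (by rw [dist_comm]; linarith))
    have hythin : μ (Metric.ball y (lam / 8 * (r / 2)) ∩ Ω) ≤ μ (Metric.ball y (r / 2) ∩ Ω) / 2 := by
      have hlr : lam * r ≤ r := mul_le_of_le_one_left hr.le hlam1
      have hdisj : Disjoint (Metric.ball y (lam / 8 * (r / 2)) ∩ Ω)
          (Metric.ball x (lam / 8 * r) ∩ Ω) := by
        refine (Metric.ball_disjoint_ball ?_).mono inter_subset_left inter_subset_left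
        rw [dist_comm]
        have : 0 < lam * r := by positivity
        linarith
      have hadd : μ (Metric.ball y (lam / 8 * (r / 2)) ∩ Ω) + μ (Metric.ball x (lam / 8 * r) ∩ Ω)
          ≤ μ (Metric.ball y (r / 2) ∩ Ω) := by
        rw [← measure_union hdisj (Metric.isOpen_ball.measurableSet.inter hΩ)]
        refine measure_mono (union_subset ?_ ?_)
        · exact inter_subset_inter_left _ (Metric.ball_subset_ball (by linarith))
        · exact inter_subset_inter_left _ (Metric.ball_subset_ball' (by linarith))
      have hhalf : μ (Metric.ball y (r / 2) ∩ Ω) / 2 ≤ μ (Metric.ball x (lam / 8 * r) ∩ Ω) :=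
        (ENNReal.div_le_div_right (measure_mono hsub1) 2).trans hcase.le
      have hne : μ (Metric.ball y (r / 2) ∩ Ω) / 2 ≠ ∞ :=
        ENNReal.div_ne_top (hfinΩ _ _).ne (by norm_num)
      refine (ENNReal.add_le_add_iff_right hne).1 ?_
      rw [ENNReal.add_halves]
      exact le_trans (by gcongr) hadd
    have h1 := hthin y hy (r / 2) (by positivity) (by linarith) hythin
    have h2 := hdoub x y (r / 2) r (by positivity) (by linarith) (by linarith)
    rw [show r / 2 / r = 1 / 2 by field_simp] at h2
    have h3 : μ.real (Metric.ball y (r / 2) ∩ Ω) ≤ μ.real (Metric.ball x r ∩ Ω) :=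
      measureReal_mono hsub1 (hfinΩ _ _).ne
    calc min c (min c' (m₀ / V₀)) * μ.real (Metric.ball x r)
        ≤ c' * μ.real (Metric.ball x r) := by
          gcongr
          exact (min_le_right _ _).trans (min_le_left _ _)
      _ = c * (κ * (1 / 2) ^ Q * μ.real (Metric.ball x r)) := by rw [hc']; ring
      _ ≤ c * μ.real (Metric.ball y (r / 2)) := by gcongr
      _ ≤ _ := h1.trans h3

end HalfRadius

theorem lqN_mono {q : ℝ≥0∞} {a b : ℤ → ℝ≥0∞} (h : ∀ k, a k ≤ b k) : lqN q a ≤ lqN q b := by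
  unfold lqN
  split_ifs with hq
  · exact iSup_mono h
  · have := ENNReal.toReal_nonneg (a := q)
    gcongr
    exact h _

theorem le_lqN {q : ℝ≥0∞} (hq : 0 < q) (a : ℤ → ℝ≥0∞) (k : ℤ) : a k ≤ lqN q a := by
  unfold lqN
  split_ifs with hq'
  · exact le_iSup a k
  · have hq0 : 0 < q.toReal := ENNReal.toReal_pos hq.ne' hq'
    calc a k = (a k ^ q.toReal) ^ (1 / q.toReal) := by
          rw [← ENNReal.rpow_mul, mul_one_div_cancel hq0.ne', ENNReal.rpow_one]
      _ ≤ _ := by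
          gcongr
          exact ENNReal.le_tsum k

theorem lqN_const_mul {q : ℝ≥0∞} (hq : 0 < q) (D : ℝ≥0∞) (a : ℤ → ℝ≥0∞) :
    lqN q (fun k => D * a k) = D * lqN q a := by
  unfold lqN
  split_ifs with hq'
  · rw [ENNReal.mul_iSup]
  · have hq0 : 0 < q.toReal := ENNReal.toReal_pos hq.ne' hq'
    simp_rw [ENNReal.mul_rpow_of_nonneg _ _ hq0.le]
    rw [ENNReal.tsum_mul_left, ENNReal.mul_rpow_of_nonneg _ _ (by positivity),
      ← ENNReal.rpow_mul, mul_one_div_cancel hq0.ne', ENNReal.rpow_one]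

theorem lqN_shift (q : ℝ≥0∞) (a : ℤ → ℝ≥0∞) (n : ℤ) :
    lqN q (fun k => a (k - n)) = lqN q a := by
  unfold lqN
  split_ifs
  · exact (Equiv.subRight n).iSup_comp (g := a)
  · rw [← (Equiv.subRight n).tsum_eq (fun k => a k ^ q.toReal)]
    rfl

theorem lqN_zero {q : ℝ≥0∞} (hq : 0 < q) : lqN q (fun _ => 0) = 0 := by
  simpa using lqN_const_mul hq 0 (fun _ => 0)

theorem lqN_geometric_ne_top {q : ℝ≥0∞} (hq : 0 < q) {δ : ℝ} (hδ : 0 < δ) :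
    lqN q (fun k : ℤ => ENNReal.ofReal ((2 : ℝ) ^ (-(|k| : ℝ) * δ))) ≠ ∞ := by
  unfold lqN
  split_ifs with hq'
  · refine ne_top_of_le_ne_top ENNReal.one_ne_top (iSup_le fun k => ?_)
    rw [← ENNReal.ofReal_one]
    refine ENNReal.ofReal_le_ofReal (Real.rpow_le_one_of_one_le_of_nonpos (by norm_num) ?_)
    have : 0 ≤ |(k : ℝ)| := abs_nonneg _
    nlinarith
  · have hq0 : 0 < q.toReal := ENNReal.toReal_pos hq.ne' hq'
    refine ENNReal.rpow_ne_top_of_nonneg (by positivity) ?_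
    have hsum : Summable fun k : ℤ => ((2 : ℝ) ^ (-(|k| : ℝ) * δ)) ^ q.toReal := by
      have hgeo : Summable fun n : ℕ => ((2 : ℝ) ^ (-(δ * q.toReal))) ^ n :=
        summable_geometric_of_lt_one (by positivity)
          (Real.rpow_lt_one_of_one_lt_of_neg (by norm_num) (by simpa using mul_pos hδ hq0))
      have hterm : ∀ n : ℕ, ((2 : ℝ) ^ (-(δ * q.toReal))) ^ n =
          ((2 : ℝ) ^ (-(n : ℝ) * δ)) ^ q.toReal := by
        intro n
        rw [← Real.rpow_natCast, ← Real.rpow_mul (by norm_num), ← Real.rpow_mul (by norm_num)]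
        congr 1
        ring
      refine Summable.of_nat_of_neg ?_ ?_ <;>
        simpa only [Int.cast_neg, abs_neg, Int.cast_natCast, Nat.abs_cast, hterm] using hgeo
    have := hsum.tsum_ofReal_ne_top
    simpa only [ENNReal.ofReal_rpow_of_pos (Real.rpow_pos_of_pos (by norm_num : (0 : ℝ) < 2) _)]
      using this

/-- The two competing bounds for the gradient of a bump of width `L` at the scale `2 ^ (-k)`. -/
def bumpCoeff (s α c L : ℝ) (k : ℤ) : ℝ :=
  min ((2 : ℝ) ^ (((k : ℝ) + 1) * s)) (c * (2 : ℝ) ^ (-(k : ℝ) * (α - s)) / L)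

theorem bumpCoeff_nonneg {s α c L : ℝ} (hc : 0 ≤ c) (hL : 0 < L) (k : ℤ) :
    0 ≤ bumpCoeff s α c L k := by
  unfold bumpCoeff
  positivity

theorem bumpCoeff_le {s α c L : ℝ} (hs : 0 < s) (hsα : s < α) (hc : 1 ≤ c) (hL : 0 < L) :
    ∃ n : ℤ, ∀ k : ℤ, bumpCoeff s α c L k ≤
      c * 2 ^ α * L ^ (-(s / α)) * (2 : ℝ) ^ (-|((k - n : ℤ) : ℝ)| * min s (α - s)) := by
  have hα : 0 < α := hs.trans hsα
  obtain ⟨t, ht, htL⟩ : ∃ t : ℝ, 0 < t ∧ t ^ α = L :=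
    ⟨L ^ (1 / α), by positivity, by rw [← Real.rpow_mul hL.le, one_div_mul_cancel hα.ne',
      Real.rpow_one]⟩
  obtain ⟨n, hn1, hn2⟩ := exists_mem_Ico_zpow (x := t⁻¹) (y := (2 : ℝ)) (by positivity)
    (by norm_num)
  have hts : L ^ (-(s / α)) = t ^ (-s) := by
    rw [← htL, ← Real.rpow_mul ht.le]
    congr 1
    field_simp
  have h2 : (0 : ℝ) < 2 := by norm_num
  have hn1' : (2 : ℝ) ^ (n : ℝ) ≤ t⁻¹ := by rwa [Real.rpow_intCast]
  have hn2' : (2 : ℝ) ^ (-(n : ℝ)) ≤ 2 * t := by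
    rw [Real.rpow_neg h2.le, Real.rpow_intCast]
    rw [zpow_add_one₀ h2.ne', inv_lt_iff_one_lt_mul₀ ht] at hn2
    rw [inv_le_iff_one_le_mul₀ (by positivity)]
    linarith
  refine ⟨n, fun k => ?_⟩
  rw [hts]
  have hpos : 0 < c * 2 ^ α * t ^ (-s) := by positivity
  rcases le_or_gt k n with hkn | hkn
  · have hcast : |((k - n : ℤ) : ℝ)| = n - k := by
      rw [abs_of_nonpos (by exact_mod_cast sub_nonpos.2 hkn)]
      push_cast; ring
    have hkn' : (0 : ℝ) ≤ n - k := sub_nonneg.2 (by exact_mod_cast hkn)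
    calc bumpCoeff s α c L k ≤ (2 : ℝ) ^ (((k : ℝ) + 1) * s) := min_le_left _ _
      _ = 2 ^ s * ((2 : ℝ) ^ (n : ℝ)) ^ s * (2 : ℝ) ^ (-((n : ℝ) - k) * s) := by
          rw [← Real.rpow_mul h2.le, ← Real.rpow_add h2, ← Real.rpow_add h2]
          congr 1; ring
      _ ≤ (c * 2 ^ α) * t ^ (-s) * (2 : ℝ) ^ (-((n : ℝ) - k) * min s (α - s)) := by
          have e1 : ((2 : ℝ) ^ (n : ℝ)) ^ s ≤ t ^ (-s) := by
            rw [Real.rpow_neg ht.le, ← Real.inv_rpow ht.le]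
            gcongr
          have e2 : (2 : ℝ) ^ s ≤ c * 2 ^ α := by
            calc (2 : ℝ) ^ s ≤ 1 * 2 ^ α := by
                  rw [one_mul]; exact Real.rpow_le_rpow_of_exponent_le (by norm_num) hsα.le
              _ ≤ _ := by gcongr
          have e3 : (2 : ℝ) ^ (-((n : ℝ) - k) * s) ≤
              (2 : ℝ) ^ (-((n : ℝ) - k) * min s (α - s)) := by
            refine Real.rpow_le_rpow_of_exponent_le (by norm_num) ?_
            have := min_le_left s (α - s)
            nlinarith
          gcongr
      _ = _ := by rw [hcast]
  · have hcast : |((k - n : ℤ) : ℝ)| = k - n := by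
      rw [abs_of_nonneg (by exact_mod_cast (sub_pos.2 hkn).le)]
      push_cast; ring
    have hkn' : (0 : ℝ) ≤ k - n := sub_nonneg.2 (by exact_mod_cast hkn.le)
    calc bumpCoeff s α c L k ≤ c * (2 : ℝ) ^ (-(k : ℝ) * (α - s)) / L := min_le_right _ _
      _ = c * (((2 : ℝ) ^ (-(n : ℝ))) ^ (α - s) * t ^ (-α)) *
          (2 : ℝ) ^ (-((k : ℝ) - n) * (α - s)) := by
          rw [← Real.rpow_mul h2.le, ← htL, Real.rpow_neg ht.le]
          have : (2 : ℝ) ^ (-(k : ℝ) * (α - s)) =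
              (2 : ℝ) ^ (-(n : ℝ) * (α - s)) * (2 : ℝ) ^ (-((k : ℝ) - n) * (α - s)) := by
            rw [← Real.rpow_add h2]
            congr 1; ring
          rw [this]
          ring
      _ ≤ c * (2 ^ α * t ^ (-s)) * (2 : ℝ) ^ (-((k : ℝ) - n) * min s (α - s)) := by
          have e1 : ((2 : ℝ) ^ (-(n : ℝ))) ^ (α - s) * t ^ (-α) ≤ 2 ^ α * t ^ (-s) := by
            calc ((2 : ℝ) ^ (-(n : ℝ))) ^ (α - s) * t ^ (-α)
                ≤ (2 * t) ^ (α - s) * t ^ (-α) := by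
                  have : 0 ≤ α - s := by linarith
                  gcongr
              _ = 2 ^ (α - s) * t ^ (-s) := by
                  rw [Real.mul_rpow h2.le ht.le, mul_assoc, ← Real.rpow_add ht]
                  congr 2; ring
              _ ≤ 2 ^ α * t ^ (-s) := by
                  gcongr
                  · norm_num
                  · linarith
          have e3 : (2 : ℝ) ^ (-((k : ℝ) - n) * (α - s)) ≤
              (2 : ℝ) ^ (-((k : ℝ) - n) * min s (α - s)) := by
            refine Real.rpow_le_rpow_of_exponent_le (by norm_num) ?_
            have := min_le_right s (α - s)
            nlinarith
          gcongr
      _ = _ := by rw [hcast]; ring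

theorem exists_lqN_bumpCoeff_le {s α c : ℝ} {q : ℝ≥0∞} (hs : 0 < s) (hq : 0 < q)
    (hαs : (q = ∞ ∧ α = s) ∨ s < α) (hc : 1 ≤ c) :
    ∃ W : ℝ, 0 < W ∧ ∀ L : ℝ, 0 < L →
      lqN q (fun k => ENNReal.ofReal (bumpCoeff s α c L k)) ≤
        ENNReal.ofReal (W * L ^ (-(s / α))) := by
  rcases hαs with ⟨rfl, rfl⟩ | hsα
  · refine ⟨c, by linarith, fun L hL => ?_⟩
    simp only [lqN, if_true]
    refine iSup_le fun k => ENNReal.ofReal_le_ofReal ?_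
    refine (min_le_right _ _).trans_eq ?_
    rw [sub_self, mul_zero, Real.rpow_zero, div_self hs.ne', Real.rpow_neg_one]
    ring
  · set a : ℤ → ℝ≥0∞ := fun k => ENNReal.ofReal ((2 : ℝ) ^ (-|(k : ℝ)| * min s (α - s)))
    have hG : lqN q a ≠ ∞ := lqN_geometric_ne_top hq (lt_min hs (by linarith))
    refine ⟨c * 2 ^ α * ((lqN q a).toReal + 1), by positivity, fun L hL => ?_⟩
    obtain ⟨n, hn⟩ := bumpCoeff_le hs hsα hc hL
    calc lqN q (fun k => ENNReal.ofReal (bumpCoeff s α c L k))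
        ≤ lqN q (fun k => ENNReal.ofReal (c * 2 ^ α * L ^ (-(s / α))) * a (k - n)) :=
          lqN_mono fun k => by
            rw [← ENNReal.ofReal_mul (by positivity)]
            exact ENNReal.ofReal_le_ofReal (hn k)
      _ = ENNReal.ofReal (c * 2 ^ α * L ^ (-(s / α))) * lqN q a := by
          rw [lqN_const_mul hq, lqN_shift q a n]
      _ ≤ ENNReal.ofReal (c * 2 ^ α * L ^ (-(s / α))) *
          ENNReal.ofReal ((lqN q a).toReal + 1) := by
          gcongr
          rw [← ENNReal.ofReal_toReal hG]
          refine ENNReal.ofReal_le_ofReal ?_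
          rw [ENNReal.toReal_ofReal ENNReal.toReal_nonneg]
          linarith
      _ = _ := by
          rw [← ENNReal.ofReal_mul (by positivity)]
          congr 1
          ring

theorem lpN_le_of_le_indicator {X : Type*} [MeasurableSpace X] {ν : Measure X} {p : ℝ}
    (hp : 0 < p) {f : X → ℝ≥0∞} {B : Set X} (hB : MeasurableSet B) {G : ℝ≥0∞}
    (hf : ∀ y, f y ≤ B.indicator (fun _ => G) y) : lpN ν p f ≤ G * ν B ^ (1 / p) := by
  unfold lpN
  calc (∫⁻ y, f y ^ p ∂ν) ^ (1 / p) ≤ (∫⁻ y, B.indicator (fun _ => G ^ p) y ∂ν) ^ (1 / p) := by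
        gcongr with y
        refine (ENNReal.rpow_le_rpow (hf y) hp.le).trans_eq ?_
        by_cases hy : y ∈ B <;> simp [hy, hp]
    _ = G * ν B ^ (1 / p) := by
        rw [lintegral_indicator_const hB, ENNReal.mul_rpow_of_nonneg _ _ (by positivity),
          ← ENNReal.rpow_mul, mul_one_div_cancel hp.ne', ENNReal.rpow_one]

section Bump

variable {X : Type*} [PseudoMetricSpace X]

/-- The radial cut-off equal to `1` on `closedBall x r'` and to `0` off `ball x r''`. -/
def bump (x : X) (r' r'' : ℝ) (y : X) : ℝ :=
  max 0 (min 1 ((r'' - dist x y) / (r'' - r')))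

variable {x y z : X} {r' r'' : ℝ}

theorem continuous_bump : Continuous (bump x r' r'') := by
  unfold bump
  fun_prop

theorem bump_nonneg : 0 ≤ bump x r' r'' y := le_max_left _ _

theorem bump_le_one : bump x r' r'' y ≤ 1 := max_le zero_le_one (min_le_left _ _)

theorem bump_eq_one (h : r' < r'') (hy : y ∈ Metric.closedBall x r') : bump x r' r'' y = 1 := by
  rw [Metric.mem_closedBall'] at hy
  have : 1 ≤ (r'' - dist x y) / (r'' - r') := by
    rw [one_le_div (by linarith)]
    linarith
  rw [bump, min_eq_left this, max_eq_right zero_le_one]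

theorem bump_eq_zero (h : r' < r'') (hy : y ∉ Metric.ball x r'') : bump x r' r'' y = 0 := by
  rw [Metric.mem_ball', not_lt] at hy
  exact max_eq_left ((min_le_right _ _).trans
    (div_nonpos_of_nonpos_of_nonneg (by linarith) (by linarith)))

theorem abs_bump_sub_le_one : |bump x r' r'' y - bump x r' r'' z| ≤ 1 := by
  rw [abs_le]
  constructor <;> linarith [@bump_nonneg X _ x y r' r'', @bump_nonneg X _ x z r' r'',
    @bump_le_one X _ x y r' r'', @bump_le_one X _ x z r' r'']

theorem abs_bump_sub_le (h : r' < r'') :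
    |bump x r' r'' y - bump x r' r'' z| ≤ dist y z / (r'' - r') := by
  have hL : 0 < r'' - r' := sub_pos.2 h
  calc |bump x r' r'' y - bump x r' r'' z|
      ≤ |min 1 ((r'' - dist x y) / (r'' - r')) - min 1 ((r'' - dist x z) / (r'' - r'))| := by
        unfold bump
        refine (abs_max_sub_max_le_max 0 _ 0 _).trans ?_
        simp
    _ ≤ |(r'' - dist x y) / (r'' - r') - (r'' - dist x z) / (r'' - r')| := by
        refine (abs_min_sub_min_le_max 1 _ 1 _).trans ?_
        simp
    _ = |dist x z - dist x y| / (r'' - r') := by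
        rw [← sub_div, abs_div, abs_of_pos hL]
        congr 2
        ring
    _ ≤ dist y z / (r'' - r') := by
        gcongr
        rw [dist_comm x z, dist_comm x y, dist_comm y z]
        exact abs_dist_sub_le z y x

variable [MeasurableSpace X] [OpensMeasurableSpace X] {ρ : X → X → ℝ} {α c s p : ℝ} {q : ℝ≥0∞}

theorem bumpCoeff_indicator_mem_fracGrad (hs : 0 < s) (hsα : s ≤ α)
    (hc : 1 ≤ c) (hcomp : ∀ x y, dist x y ≤ c * ρ x y ^ α) (μ : Measure X) (Ω : Set X) (x : X)
    (h : r' < r'') :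
    (fun k => (Metric.ball x r'').indicator (fun _ => bumpCoeff s α c (r'' - r') k)) ∈
      fracGrad ρ μ Ω s (bump x r' r'') := by
  have hL : 0 < r'' - r' := sub_pos.2 h
  have h2 : (0 : ℝ) < 2 := by norm_num
  refine ⟨fun k y => indicator_nonneg (fun _ _ => bumpCoeff_nonneg (by linarith) hL k) y,
    fun k => (measurable_const.indicator Metric.isOpen_ball.measurableSet).aemeasurable, ∅,
    measure_empty, fun k y _ z _ hk1 hk2 => ?_⟩
  have hρ : 0 < ρ y z := lt_of_lt_of_le (by positivity) hk1
  have hcoeff : |bump x r' r'' y - bump x r' r'' z| ≤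
      ρ y z ^ s * bumpCoeff s α c (r'' - r') k := by
    unfold bumpCoeff
    rw [mul_min_of_nonneg _ _ (by positivity)]
    refine le_min ?_ ?_
    · refine abs_bump_sub_le_one.trans ?_
      calc (1 : ℝ) = ((2 : ℝ) ^ (-k - 1)) ^ s * (2 : ℝ) ^ (((k : ℝ) + 1) * s) := by
            rw [← Real.rpow_intCast, ← Real.rpow_mul h2.le, ← Real.rpow_add h2]
            push_cast
            ring_nf
            simp
        _ ≤ _ := by gcongr
    · refine (abs_bump_sub_le h).trans ?_
      rw [← mul_div_assoc]
      gcongr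
      refine (hcomp y z).trans ?_
      have e : ρ y z ^ α = ρ y z ^ s * ρ y z ^ (α - s) := by
        rw [← Real.rpow_add hρ]; congr 1; ring
      have e2 : ρ y z ^ (α - s) ≤ (2 : ℝ) ^ (-(k : ℝ) * (α - s)) := by
        rw [Real.rpow_mul h2.le]
        refine Real.rpow_le_rpow hρ.le ?_ (by linarith)
        rw [← Int.cast_neg, Real.rpow_intCast]
        exact hk2.le
      calc c * ρ y z ^ α = ρ y z ^ s * (c * ρ y z ^ (α - s)) := by rw [e]; ring
        _ ≤ _ := by gcongr
  have h0 : 0 ≤ bumpCoeff s α c (r'' - r') k := bumpCoeff_nonneg (by linarith) hL k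
  have hρs : 0 ≤ ρ y z ^ s := by positivity
  by_cases hy : y ∈ Metric.ball x r'' <;> by_cases hz : z ∈ Metric.ball x r''
  · simp only [indicator_of_mem hy, indicator_of_mem hz]
    nlinarith
  · simpa only [indicator_of_mem hy, indicator_of_notMem hz, add_zero] using hcoeff
  · simpa only [indicator_of_mem hz, indicator_of_notMem hy, zero_add] using hcoeff
  · simp only [indicator_of_notMem hz, indicator_of_notMem hy, bump_eq_zero h hy,
      bump_eq_zero h hz]
    simp

theorem exists_bump_norm_le (hs : 0 < s) (hp : 0 < p) (hq : 0 < q)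
    (hαs : (q = ∞ ∧ α = s) ∨ s < α) (hc : 1 ≤ c) (hcomp : ∀ x y, dist x y ≤ c * ρ x y ^ α) :
    ∃ W : ℝ, 0 < W ∧ ∀ (μ : Measure X) (Ω : Set X) (x : X) (r' r'' : ℝ), r' < r'' →
      r'' - r' ≤ 1 → μ (Metric.ball x r'' ∩ Ω) < ∞ →
      MemMspq ρ μ Ω s p q (bump x r' r'') ∧
      MNorm ρ μ Ω s p q (bump x r' r'') ≤
        ENNReal.ofReal (W * (r'' - r') ^ (-(s / α))) * μ (Metric.ball x r'' ∩ Ω) ^ (1 / p) := by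
  obtain ⟨W, hW, hWL⟩ := exists_lqN_bumpCoeff_le (c := c) hs hq hαs hc
  have hsα : s ≤ α := by rcases hαs with h | h <;> linarith
  refine ⟨W + 1, by positivity, fun μ Ω x r' r'' h h1 hfin => ?_⟩
  have hL : 0 < r'' - r' := sub_pos.2 h
  have hB : MeasurableSet (Metric.ball x r'') := Metric.isOpen_ball.measurableSet
  have hM : MdotNorm ρ μ Ω s p q (bump x r' r'') ≤
      ENNReal.ofReal (W * (r'' - r') ^ (-(s / α))) * μ (Metric.ball x r'' ∩ Ω) ^ (1 / p) := by
    refine (iInf₂_le _ (bumpCoeff_indicator_mem_fracGrad hs hsα hc hcomp μ Ω x h)).trans ?_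
    rw [← Measure.restrict_apply hB]
    refine lpN_le_of_le_indicator hp hB fun y => ?_
    by_cases hy : y ∈ Metric.ball x r''
    · simpa only [indicator_of_mem hy] using hWL _ hL
    · simp only [indicator_of_notMem hy, ENNReal.ofReal_zero, lqN_zero hq, le_refl]
  have hLp : lpOn μ Ω p (bump x r' r'') ≤
      ENNReal.ofReal ((r'' - r') ^ (-(s / α))) * μ (Metric.ball x r'' ∩ Ω) ^ (1 / p) := by
    rw [← Measure.restrict_apply hB]
    refine lpN_le_of_le_indicator hp hB fun y => ?_
    by_cases hy : y ∈ Metric.ball x r''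
    · rw [indicator_of_mem hy, abs_of_nonneg bump_nonneg]
      refine ENNReal.ofReal_le_ofReal (bump_le_one.trans ?_)
      exact Real.one_le_rpow_of_pos_of_le_one_of_nonpos hL h1
        (neg_nonpos.2 (div_nonneg hs.le (hs.le.trans hsα)))
    · rw [indicator_of_notMem hy, bump_eq_zero h hy]
      simp
  have hfin' : μ (Metric.ball x r'' ∩ Ω) ^ (1 / p) ≠ ∞ :=
    ENNReal.rpow_ne_top_of_nonneg (by positivity) hfin.ne
  refine ⟨⟨continuous_bump.measurable.aemeasurable,
    ne_top_of_le_ne_top (ENNReal.mul_ne_top ENNReal.ofReal_ne_top hfin') hLp,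
    ne_top_of_le_ne_top (ENNReal.mul_ne_top ENNReal.ofReal_ne_top hfin') hM⟩, ?_⟩
  refine (add_le_add hM hLp).trans_eq ?_
  rw [← add_mul, ← ENNReal.ofReal_add (by positivity) (by positivity)]
  congr 2
  ring

end Bump

theorem exists_dominating {X : Type*} [MeasurableSpace X] {ρ : X → X → ℝ} {μ : Measure X}
    {s p : ℝ} {q : ℝ≥0∞} (hρ : IsQuasiDist ρ) (hp : 0 < p) (hq : 0 < q) {v : X → ℝ}
    {T : ℝ≥0∞} (hv : MdotNorm ρ μ Set.univ s p q v < T) :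
    ∃ h : X → ℝ≥0∞, AEMeasurable h μ ∧ ∫⁻ y, h y ^ p ∂μ ≤ T ^ p ∧
      ∃ E : Set X, μ E = 0 ∧ ∀ y ∉ E, ∀ z ∉ E, ∀ l : ℝ, 0 ≤ l → h y ≤ ENNReal.ofReal l →
        h z ≤ ENNReal.ofReal l → |v y - v z| ≤ ρ y z ^ s * (2 * l) := by
  simp only [MdotNorm, iInf_lt_iff, Measure.restrict_univ] at hv
  obtain ⟨g, ⟨-, hgm, E, hE, hg⟩, hgT⟩ := hv
  rw [Measure.restrict_univ] at hgm
  refine ⟨fun y => lqN q fun k => ENNReal.ofReal (g k y), ?_, ?_, E, hE, ?_⟩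
  · unfold lqN
    split_ifs
    · exact AEMeasurable.iSup fun k => (hgm k).ennreal_ofReal
    · exact (AEMeasurable.tsum fun k => (hgm k).ennreal_ofReal.pow_const _).pow_const _
  · have := ENNReal.rpow_le_rpow hgT.le hp.le
    rwa [lpN, ← ENNReal.rpow_mul, one_div_mul_cancel hp.ne', ENNReal.rpow_one] at this
  · intro y hy z hz l hl hyl hzl
    rcases (hρ.1 y z).eq_or_lt with h0 | h0
    · have hyz : y = z := (hρ.2.1 y z).1 h0.symm
      subst hyz
      simpa using mul_nonneg (Real.rpow_nonneg (hρ.1 y y) s) (by positivity)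
    · obtain ⟨n, hn1, hn2⟩ := exists_mem_Ico_zpow h0 (one_lt_two (α := ℝ))
      have key := hg (-(n + 1)) y ⟨mem_univ _, hy⟩ z ⟨mem_univ _, hz⟩
        (by rwa [show - -(n + 1) - 1 = n by ring]) (by rwa [neg_neg])
      have hle : ∀ w, (lqN q fun k => ENNReal.ofReal (g k w)) ≤ ENNReal.ofReal l →
          g (-(n + 1)) w ≤ l := fun w hw =>
        (ENNReal.ofReal_le_ofReal_iff hl).1 ((le_lqN hq _ (-(n + 1))).trans hw)
      refine key.trans ?_
      gcongr
      linarith [hle y hyl, hle z hzl]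

theorem step_of_extension {X : Type*} [PseudoMetricSpace X] [MeasurableSpace X]
    [OpensMeasurableSpace X] {ρ : X → X → ℝ} {μ : Measure X} {Ω : Set X}
    {α c s p κ Q C : ℝ} {q : ℝ≥0∞} (hρ : IsQuasiDist ρ) (hs : 0 < s) (hp : 0 < p) (hq : 0 < q)
    (hαs : (q = ∞ ∧ α = s) ∨ s < α) (hc : 1 ≤ c)
    (hcomp : ∀ x y, dist x y ≤ c * ρ x y ^ α ∧ ρ x y ^ α ≤ c * dist x y)
    (hΩ : MeasurableSet Ω) (hpos : ∀ x ∈ Ω, ∀ r, 0 < r → 0 < μ (Metric.ball x r ∩ Ω))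
    (hfin : ∀ x r, μ (Metric.ball x r) < ∞) (hκ : 0 < κ) (hsQ : s / α * p < Q)
    (hdoub : ∀ x y r R, 0 < r → r ≤ R → dist x y ≤ 3 * R →
      κ * (r / R) ^ Q * μ.real (Metric.ball x R) ≤ μ.real (Metric.ball y r))
    (hC : 0 < C)
    (hext : ∀ u : X → ℝ, MemMspq ρ μ Ω s p q u →
      ∃ v : X → ℝ, MemMspq ρ μ Set.univ s p q v ∧
        (∀ᵐ x ∂μ.restrict Ω, v x = u x) ∧
        MNorm ρ μ Set.univ s p q v ≤ ENNReal.ofReal C * MNorm ρ μ Ω s p q u) :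
    ∃ K : ℝ, 0 < K ∧ ∀ x ∈ Ω, ∀ R r' r'', 0 < R → R ≤ 1 → 0 ≤ r' → r' < r'' → r'' < R →
      μ (Metric.ball x r'' ∩ Ω) / 2 ≤ μ (Metric.closedBall x r' ∩ Ω) →
      μ (Metric.ball x r'' ∩ Ω) / 2 ≤ μ ((Metric.ball x R \ Metric.ball x r'') ∩ Ω) →
      r'' - r' ≤ K * R *
        (μ.real (Metric.ball x r'' ∩ Ω) / μ.real (Metric.ball x R)) ^ (1 / Q) := by
  have hα : 0 < α := by rcases hαs with h | h <;> linarith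
  set σ := s / α with hσdef
  have hσ : 0 < σ := div_pos hs hα
  have hQ : 0 < Q := lt_trans (by positivity) hsQ
  obtain ⟨W, hW, hbump⟩ := exists_bump_norm_le (ρ := ρ) hs hp hq hαs hc fun x y => (hcomp x y).1
  have hρdist : ∀ x y, ρ x y ^ s ≤ c ^ σ * dist x y ^ σ := fun x y => by
    rw [← Real.mul_rpow (by linarith) dist_nonneg]
    calc ρ x y ^ s = (ρ x y ^ α) ^ σ := by
          rw [← Real.rpow_mul (hρ.1 x y), hσdef, mul_div_cancel₀ _ hα.ne']
      _ ≤ _ := Real.rpow_le_rpow (Real.rpow_nonneg (hρ.1 x y) _) (hcomp x y).2 hσ.le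
  obtain ⟨D, hD, hcap⟩ := capacity_bound (X := X) (A := 2 * c ^ σ) hσ hp (by positivity) hsQ
  set N₀ : ℝ := 4 ^ (1 / p) * (2 * C * W) with hN₀
  have hN₀pos : 0 < N₀ := by positivity
  refine ⟨(D * N₀) ^ (1 / σ) * (1 / (2 * κ)) ^ (1 / Q), by positivity, ?_⟩
  intro x hx R r' r'' hR hR1 hr' hrr hrR hhalf hhalf'
  set L := r'' - r' with hLdef
  have hL : 0 < L := sub_pos.2 hrr
  have hBfin : μ (Metric.ball x r'' ∩ Ω) < ∞ :=
    (measure_mono inter_subset_left).trans_lt (hfin x r'')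
  set M := μ.real (Metric.ball x r'' ∩ Ω) with hM
  have hMpos : 0 < M := ENNReal.toReal_pos (hpos x hx r'' (by linarith)).ne' hBfin.ne
  have hMeq : μ (Metric.ball x r'' ∩ Ω) = ENNReal.ofReal M := (ENNReal.ofReal_toReal hBfin.ne).symm
  have hMhalf : μ (Metric.ball x r'' ∩ Ω) / 2 = ENNReal.ofReal (M / 2) := by
    rw [hMeq, ENNReal.ofReal_div_of_pos (by norm_num)]
    simp
  set P := μ.real (Metric.ball x R) with hP
  have hPpos : 0 < P := ENNReal.toReal_pos
    ((hpos x hx R hR).trans_le (measure_mono inter_subset_left)).ne' (hfin x R).ne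
  obtain ⟨hmem, hnorm⟩ := hbump μ Ω x r' r'' hrr (by linarith) hBfin
  obtain ⟨v, -, hvu, hvn⟩ := hext _ hmem
  set T : ℝ := 2 * C * W * L ^ (-σ) * M ^ (1 / p) with hT
  have hTlt : MdotNorm ρ μ Set.univ s p q v < ENNReal.ofReal T := by
    calc MdotNorm ρ μ Set.univ s p q v ≤ MNorm ρ μ Set.univ s p q v := le_self_add
      _ ≤ ENNReal.ofReal C * (ENNReal.ofReal (W * L ^ (-σ)) *
          μ (Metric.ball x r'' ∩ Ω) ^ (1 / p)) := hvn.trans (by gcongr)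
      _ = ENNReal.ofReal (C * W * L ^ (-σ) * M ^ (1 / p)) := by
          rw [hMeq, ENNReal.ofReal_rpow_of_pos hMpos, ← ENNReal.ofReal_mul (by positivity),
            ← ENNReal.ofReal_mul hC.le]
          congr 1
          ring
      _ < ENNReal.ofReal T := by
          rw [ENNReal.ofReal_lt_ofReal_iff (by positivity), hT]
          have : 0 < C * W * L ^ (-σ) * M ^ (1 / p) := by positivity
          linarith
  obtain ⟨h, hhm, hhint, E, hE, hhE⟩ := exists_dominating hρ hp hq hTlt
  have hE₀ : μ {y | ¬(y ∈ Ω → v y = bump x r' r'' y)} = 0 := by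
    rw [ae_restrict_iff' hΩ] at hvu
    exact hvu
  set E₀ := {y | ¬(y ∈ Ω → v y = bump x r' r'' y)} with hE₀def
  have hvE : ∀ A : Set X, ∀ y ∈ (A ∩ Ω) \ E₀, v y = bump x r' r'' y := fun A y hy => by
    by_contra hne
    exact hy.2 fun hall => hne (hall hy.1.2)
  have hb : 0 < κ * P / R ^ Q := by positivity
  have key := hcap μ x R (κ * P / R ^ Q) (M / 2) (N₀ * L ^ (-σ)) v h E
    ((Metric.closedBall x r' ∩ Ω) \ E₀) (((Metric.ball x R \ Metric.ball x r'') ∩ Ω) \ E₀)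
    hR.le hb (by positivity) (by positivity) ?_ hhm ?_ hE ?_ ?_ ?_ ?_ ?_ ?_
  · set V := M / 2 / (κ * P / R ^ Q) with hV
    have hVpos : 0 < V := by positivity
    have h1 : L ^ σ ≤ D * N₀ * (V ^ (1 / Q)) ^ σ := by
      have hLσ : 0 < L ^ σ := by positivity
      rw [Real.rpow_neg hL.le] at key
      calc L ^ σ = L ^ σ * 1 := (mul_one _).symm
        _ ≤ L ^ σ * (D * (N₀ * (L ^ σ)⁻¹) * (V ^ (1 / Q)) ^ σ) := by gcongr
        _ = _ := by field_simp
    have h2 : L ≤ (D * N₀) ^ (1 / σ) * V ^ (1 / Q) := by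
      have := Real.rpow_le_rpow (by positivity) h1 (by positivity : 0 ≤ 1 / σ)
      rwa [← Real.rpow_mul hL.le, mul_one_div_cancel hσ.ne', Real.rpow_one,
        Real.mul_rpow (by positivity) (by positivity), ← Real.rpow_mul (by positivity),
        mul_one_div_cancel hσ.ne', Real.rpow_one] at this
    refine h2.trans_eq ?_
    have h3 : V = 1 / (2 * κ) * R ^ Q * (M / P) := by
      rw [hV]; field_simp
    have h4 : V ^ (1 / Q) = (1 / (2 * κ)) ^ (1 / Q) * R * (M / P) ^ (1 / Q) := by
      rw [h3, Real.mul_rpow (by positivity) (by positivity),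
        Real.mul_rpow (by positivity) (by positivity), ← Real.rpow_mul hR.le,
        mul_one_div_cancel hQ.ne', Real.rpow_one]
    rw [h4]
    ring
  · intro y r hxy hr hrR
    rw [← ENNReal.ofReal_toReal (hfin y r).ne]
    refine ENNReal.ofReal_le_ofReal ((hdoub x y r R hr hrR hxy).trans' (le_of_eq ?_))
    rw [Real.div_rpow hr.le hR.le]
    ring
  · refine hhint.trans_eq ?_
    rw [ENNReal.ofReal_rpow_of_pos (by positivity)]
    congr 1
    have e1 : T ^ p = (2 * C * W * L ^ (-σ)) ^ p * M := by
      rw [hT, Real.mul_rpow (by positivity) (by positivity), ← Real.rpow_mul hMpos.le,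
        one_div_mul_cancel hp.ne', Real.rpow_one]
    have e2 : (N₀ * L ^ (-σ)) ^ p = 4 * (2 * C * W * L ^ (-σ)) ^ p := by
      rw [hN₀, mul_assoc, Real.mul_rpow (by positivity) (by positivity),
        ← Real.rpow_mul (by norm_num), one_div_mul_cancel hp.ne', Real.rpow_one]
    rw [e1, e2]
    ring
  · intro y hy z hz l hl hyl hzl
    refine (hhE y hy z hz l hl hyl hzl).trans ?_
    calc ρ y z ^ s * (2 * l) ≤ c ^ σ * dist y z ^ σ * (2 * l) := by gcongr; exact hρdist y z
      _ = _ := by ring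
  · exact sdiff_subset.trans (inter_subset_left.trans (Metric.closedBall_subset_closedBall
      (by linarith)))
  · exact sdiff_subset.trans (inter_subset_left.trans (sdiff_subset.trans
      Metric.ball_subset_closedBall))
  · rw [measure_sdiff_null hE₀, ← hMhalf]
    exact hhalf
  · rw [measure_sdiff_null hE₀, ← hMhalf]
    exact hhalf'
  · intro y hy z hz
    rw [hvE _ y hy, hvE _ z hz, bump_eq_one hrr hy.1.1, bump_eq_zero hrr hz.1.1.2]
    simp

section Transfer

variable {X : Type*} [PseudoMetricSpace X] [MeasurableSpace X] {ρ : X → X → ℝ} {μ : Measure X}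
  {Ω : Set X} {α c : ℝ}

theorem measure_ball_lt_top_of_comparison (hX : IsQMMS ρ μ) (hα : 0 < α) (hc : 1 ≤ c)
    (hcomp : ∀ x y, dist x y ≤ c * ρ x y ^ α ∧ ρ x y ^ α ≤ c * dist x y) (x : X) (r : ℝ) :
    μ (Metric.ball x r) < ∞ := by
  refine (measure_mono ((Metric.ball_subset_ball (le_max_left r 1)).trans
    (ball_subset_qball hX.quasi.1 hα hc hcomp x))).trans_lt (hX.ball_lt_top _ _ ?_)
  have : 0 < max r 1 := by positivity
  positivity

theorem exists_metric_doubling (hX : IsQMMS ρ μ) (hα : 0 < α) (hc : 1 ≤ c)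
    (hcomp : ∀ x y, dist x y ≤ c * ρ x y ^ α ∧ ρ x y ^ α ≤ c * dist x y) {Q Q' : ℝ}
    (hdoub : QDoubling ρ μ Q) (hQ' : Q / α ≤ Q') :
    ∃ κ : ℝ, 0 < κ ∧ ∀ (x y : X) (r R : ℝ), 0 < r → r ≤ R → dist x y ≤ 3 * R →
      κ * (r / R) ^ Q' * μ.real (Metric.ball x R) ≤ μ.real (Metric.ball y r) := by
  obtain ⟨κ, hκ, hdoub⟩ := hdoub
  have hfin := measure_ball_lt_top_of_comparison hX hα hc hcomp
  refine ⟨κ * (1 / (5 * c ^ 2)) ^ (Q / α), by positivity, fun x y r R hr hrR hxy => ?_⟩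
  have hR : 0 < R := hr.trans_le hrR
  have hsub : qball ρ y ((r / c) ^ (1 / α)) ⊆ Metric.ball y r :=
    qball_subset_ball hX.quasi.1 hα hc hcomp y hr
  have hsub' : Metric.ball x (5 * R) ⊆ qball ρ x ((c * (5 * R)) ^ (1 / α)) :=
    ball_subset_qball hX.quasi.1 hα hc hcomp x
  have hball : Metric.ball y r ⊆ Metric.ball x (5 * R) :=
    Metric.ball_subset_ball' (by rw [dist_comm y x]; linarith)
  have hle : r / c ≤ c * (5 * R) :=
    (div_le_self hr.le hc).trans (by nlinarith)
  have key := hdoub y x ((r / c) ^ (1 / α)) ((c * (5 * R)) ^ (1 / α)) (by positivity)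
    (by gcongr) (hsub.trans (hball.trans hsub'))
  have hratio : (1 / (5 * c ^ 2)) ^ (Q / α) * (r / R) ^ Q' ≤
      ((r / c) ^ (1 / α) / (c * (5 * R)) ^ (1 / α)) ^ Q := by
    rw [← Real.div_rpow (by positivity) (by positivity), ← Real.rpow_mul (by positivity),
      show 1 / α * Q = Q / α by ring,
      show r / c / (c * (5 * R)) = 1 / (5 * c ^ 2) * (r / R) by field_simp,
      Real.mul_rpow (by positivity) (by positivity)]
    gcongr ?_ * ?_
    exact Real.rpow_le_rpow_of_exponent_ge (by positivity) ((div_le_one hR).2 hrR) hQ'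
  refine (ENNReal.ofReal_le_ofReal_iff measureReal_nonneg).1 ?_
  rw [ENNReal.ofReal_mul (by positivity), ofReal_measureReal (hfin x R).ne,
    ofReal_measureReal (hfin y r).ne]
  refine le_trans ?_ (key.trans (measure_mono hsub))
  refine mul_le_mul' (ENNReal.ofReal_le_ofReal ?_) (measure_mono
    ((Metric.ball_subset_ball (by linarith)).trans hsub'))
  rw [mul_assoc]
  gcongr

theorem measure_ball_inter_pos_of_comparison (hX : IsQMMS ρ μ) (hα : 0 < α) (hc : 1 ≤ c)
    (hcomp : ∀ x y, dist x y ≤ c * ρ x y ^ α ∧ ρ x y ^ α ≤ c * dist x y)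
    (hΩpos : ∀ x ∈ Ω, ∀ r : ℝ, 0 < r → r ≤ 1 → 0 < μ (qball ρ x r ∩ Ω)) :
    ∀ x ∈ Ω, ∀ r, 0 < r → 0 < μ (Metric.ball x r ∩ Ω) := by
  intro x hx r hr
  refine (hΩpos x hx (min ((r / c) ^ (1 / α)) 1) (by positivity) (min_le_right _ _)).trans_le
    (measure_mono (inter_subset_inter_left _ fun y hy => ?_))
  exact qball_subset_ball hX.quasi.1 hα hc hcomp x hr
    (show ρ x y < _ from lt_of_lt_of_le hy (min_le_left _ _))

theorem LocUnifPerfect.metric (hX : IsQMMS ρ μ) (hα : 0 < α) (hc : 1 ≤ c)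
    (hcomp : ∀ x y, dist x y ≤ c * ρ x y ^ α ∧ ρ x y ^ α ≤ c * dist x y) {lam : ℝ}
    (hlam : 0 < lam) (hperf : LocUnifPerfect ρ Ω lam) :
    ∀ x ∈ Ω, ∀ r, 0 < r → r ≤ 1 → Ω ⊆ Metric.ball x r ∨
      ∃ y ∈ Ω, lam ^ α / c ^ 2 * r ≤ dist x y ∧ dist x y < r := by
  intro x hx r hr hr1
  have hc0 : 0 < c := by linarith
  have hsub : qball ρ x ((r / c) ^ (1 / α)) ⊆ Metric.ball x r :=
    qball_subset_ball hX.quasi.1 hα hc hcomp x hr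
  have hτ1 : (r / c) ^ (1 / α) ≤ 1 :=
    Real.rpow_le_one (by positivity) ((div_le_self hr.le hc).trans hr1) (by positivity)
  rcases (Ω \ qball ρ x ((r / c) ^ (1 / α))).eq_empty_or_nonempty with he | hne
  · exact Or.inl ((sdiff_eq_bot_iff.1 he).trans hsub)
  · obtain ⟨y, ⟨hy, hyΩ⟩, hy'⟩ := hperf x hx _ (by positivity) hτ1 hne
    refine Or.inr ⟨y, hyΩ, ?_, Metric.mem_ball'.1 (hsub hy)⟩
    have h1 : lam * (r / c) ^ (1 / α) ≤ ρ x y := not_lt.1 hy'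
    have h2 : lam ^ α * (r / c) ≤ c * dist x y := by
      calc lam ^ α * (r / c) = (lam * (r / c) ^ (1 / α)) ^ α := by
            rw [Real.mul_rpow hlam.le (by positivity), ← Real.rpow_mul (by positivity),
              one_div_mul_cancel hα.ne', Real.rpow_one]
        _ ≤ ρ x y ^ α := by gcongr
        _ ≤ _ := (hcomp x y).2
    rw [← mul_le_mul_iff_right₀ hc0]
    refine le_trans (le_of_eq ?_) h2
    field_simp

theorem measDensity_of_metric_density (hX : IsQMMS ρ μ) (hα : 0 < α) (hc : 1 ≤ c)
    (hcomp : ∀ x y, dist x y ≤ c * ρ x y ^ α ∧ ρ x y ^ α ≤ c * dist x y) {κ Q c' : ℝ}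
    (hκ : 0 < κ)
    (hdoub : ∀ (x y : X) (r R : ℝ), 0 < r → r ≤ R → dist x y ≤ 3 * R →
      κ * (r / R) ^ Q * μ.real (Metric.ball x R) ≤ μ.real (Metric.ball y r))
    (hc' : 0 < c') (hdens : ∀ x ∈ Ω, ∀ r, 0 < r → r ≤ 1 →
      c' * μ.real (Metric.ball x r) ≤ μ.real (Metric.ball x r ∩ Ω)) :
    MeasDensity ρ μ Ω := by
  have hfin := measure_ball_lt_top_of_comparison hX hα hc hcomp
  have hc0 : 0 < c := by linarith
  refine ⟨(c' * (κ * (1 / c ^ 2) ^ Q))⁻¹, by positivity, fun x hx r hr hr1 => ?_⟩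
  have hsub : Metric.ball x (r ^ α / c) ⊆ qball ρ x r := by
    have := ball_subset_qball hX.quasi.1 hα hc hcomp x (r := r ^ α / c)
    rwa [mul_div_cancel₀ _ hc0.ne', ← Real.rpow_mul hr.le, mul_one_div_cancel hα.ne',
      Real.rpow_one] at this
  have hsub' : qball ρ x r ⊆ Metric.ball x (c * r ^ α) := by
    have := qball_subset_ball hX.quasi.1 hα hc hcomp x (r := c * r ^ α) (by positivity)
    rwa [mul_div_cancel_left₀ _ hc0.ne', ← Real.rpow_mul hr.le, mul_one_div_cancel hα.ne',
      Real.rpow_one] at this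
  have hrα : 0 < r ^ α := by positivity
  have hrα1 : r ^ α ≤ 1 := Real.rpow_le_one hr.le hr1 hα.le
  have hle : r ^ α / c ≤ c * r ^ α := (div_le_self hrα.le hc).trans (by nlinarith)
  have h1 := hdoub x x (r ^ α / c) (c * r ^ α) (by positivity) hle
    (by rw [dist_self]; positivity)
  rw [show r ^ α / c / (c * r ^ α) = 1 / c ^ 2 by field_simp] at h1
  have h2 := hdens x hx (r ^ α / c) (by positivity) ((div_le_self hrα.le hc).trans hrα1)
  have hqfin : μ (qball ρ x r) < ∞ := hX.ball_lt_top x r hr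
  have hqfin' : μ (qball ρ x r ∩ Ω) < ∞ := (measure_mono inter_subset_left).trans_lt hqfin
  have h3 : μ.real (qball ρ x r) ≤ μ.real (Metric.ball x (c * r ^ α)) :=
    measureReal_mono hsub' (hfin _ _).ne
  have h4 : μ.real (Metric.ball x (r ^ α / c) ∩ Ω) ≤ μ.real (qball ρ x r ∩ Ω) :=
    measureReal_mono (inter_subset_inter_left _ hsub) hqfin'.ne
  rw [← ofReal_measureReal hqfin.ne, ← ofReal_measureReal hqfin'.ne,
    ← ENNReal.ofReal_mul (by positivity)]
  refine ENNReal.ofReal_le_ofReal ?_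
  rw [inv_mul_eq_div, le_div_iff₀ (by positivity)]
  calc μ.real (qball ρ x r) * (c' * (κ * (1 / c ^ 2) ^ Q))
      = c' * (κ * (1 / c ^ 2) ^ Q * μ.real (qball ρ x r)) := by ring
    _ ≤ c' * (κ * (1 / c ^ 2) ^ Q * μ.real (Metric.ball x (c * r ^ α))) := by gcongr
    _ ≤ c' * μ.real (Metric.ball x (r ^ α / c)) := by gcongr
    _ ≤ _ := h2.trans h4

end Transfer

/-- Theorem 4.4 ((b) ⟹ (a)): if a locally uniformly perfect set `Ω` is an
`M^s_{p,q}`-extension domain for some admissible `s,p,q`, then `Ω` satisfies the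
measure density condition. -/
theorem M_extension_implies_measure_density
    {X : Type*} [MeasurableSpace X] (ρ : X → X → ℝ) (μ : Measure X)
    (hX : IsQMMS ρ μ) (hreg : BorelRegular μ)
    (Q : ℝ) (hQ : 0 < Q) (hdoub : QDoubling ρ μ Q)
    (Ω : Set X) (hΩmeas : MeasurableSet Ω)
    (hΩpos : ∀ x ∈ Ω, ∀ r : ℝ, 0 < r → r ≤ 1 → 0 < μ (qball ρ x r ∩ Ω))
    (hperf : ∃ lam : ℝ, 0 < lam ∧ lam < 1 ∧ LocUnifPerfect ρ Ω lam)
    (s p : ℝ) (q : ℝ≥0∞) (hs : 0 < s) (hp : 0 < p) (hq : 0 < q)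
    (hind : SPrecIndex ρ s q)
    (hext : ∃ C : ℝ, 0 < C ∧ ∀ u : X → ℝ, MemMspq ρ μ Ω s p q u →
      ∃ v : X → ℝ, MemMspq ρ μ Set.univ s p q v ∧
        (∀ᵐ x ∂μ.restrict Ω, v x = u x) ∧
        MNorm ρ μ Set.univ s p q v ≤ ENNReal.ofReal C * MNorm ρ μ Ω s p q u) :
    MeasDensity ρ μ Ω := by
  obtain ⟨lam, hlam, hlam1, hperf⟩ := hperf
  obtain ⟨C, hC, hext⟩ := hext
  obtain ⟨α, hαs, hmetric, c, hc, hcomp⟩ := exists_snowflake hX.quasi hs hind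
  have hα : 0 < α := by rcases hαs with h | h <;> linarith
  have : OpensMeasurableSpace X := opensMeasurableSpace_of_balls hX hα hc hcomp
  set Q' : ℝ := max (Q / α) (s / α * p + 1)
  have hsQ : s / α * p < Q' := (lt_add_one _).trans_le (le_max_right _ _)
  have hQ' : 0 < Q' := lt_of_lt_of_le (by positivity) (le_max_left (Q / α) _)
  have hpos := measure_ball_inter_pos_of_comparison hX hα hc hcomp hΩpos
  have hfin := measure_ball_lt_top_of_comparison hX hα hc hcomp
  obtain ⟨κ, hκ, hdoub'⟩ := exists_metric_doubling hX hα hc hcomp hdoub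
    (le_max_left _ _ : _ ≤ Q')
  obtain ⟨K, hK, hstep⟩ := step_of_extension hX.quasi hs hp hq hαs hc hcomp hΩmeas hpos hfin hκ
    hsQ hdoub' hC hext
  have hlam' : lam ^ α / c ^ 2 ≤ 1 := div_le_one_of_le₀
    ((Real.rpow_le_one hlam.le hlam1.le hα.le).trans (one_le_pow₀ hc)) (by positivity)
  obtain ⟨c', hc', hdens⟩ := density_of_step hΩmeas hpos hfin hQ' hK hκ hdoub' hstep
    (by positivity) hlam' (hperf.metric hX hα hc hcomp hlam)
  exact measDensity_of_metric_density hX hα hc hcomp hκ hdoub' hc' hdens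

end HajlaszPaper
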